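/- arXiv:math/0403441 — 12 statements merged into one kernel-verified Lean document; each statement's English description precedes it below -/
import Mathlib

section
/- Let (B : F → G, C : G → F) be a pair of maps. Then (B, C) is a dual Galois connection between F and G if, and only if, there exist maps b : X × Y × S → T and b° : Y × X × T → S such that: (1) for all (x,y) ∈ X × Y, (b(x,y,·), b°(y,x,·)) is a dual Galois connection between S and T, i.e. for all s ∈ S and t ∈ T, t ≥ b(x,y,s) ⟺ s ≥ b°(y,x,t); (2) for all (x,t) ∈ X × T, the function b°(·,x,t) belongs to F; (3) for all (y,s) ∈ Y × S, the function b(·,y,s) belongs to G; (4) for every f ∈ F, the least upper bound in G of the family {b(·,y,f(y)) : y ∈ Y} exists and equals Bf, and for every g ∈ G, the least upper bound in F of the family {b°(·,x,g(x)) : x ∈ X} exists and equals Cg. In this case b and b° are uniquely determined by (B,C): b(·,y,s) = B(δ^s_y) and b°(·,x,t) = C(δ^t_x) for all s ∈ S, t ∈ T, x ∈ X, y ∈ Y. -/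
theorem le_dirac_iff {S Y : Type*} [Lattice S] [OrderTop S] [DecidableEq Y]
    (f : Y → S) (y : Y) (s : S) :
    f ≤ (fun y' => if y' = y then s else ⊤) ↔ f y ≤ s := by
  refine ⟨fun h => by simpa using h y, fun h y' => ?_⟩
  by_cases hy : y' = y
  · subst hy
    simpa using h
  · simp [hy]

/-- In a dual Galois connection, `B f` is the least upper bound in `G` of the images under `B` of
the Dirac functions `δ_y^{f y}`. -/
theorem isLeast_of_dualGalois {S T X Y : Type*} [Lattice S] [Lattice T] [OrderTop S]
    [DecidableEq Y] {F : Set (Y → S)} {G : Set (X → T)}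
    (hFdirac : ∀ (y : Y) (s : S), (fun y' => if y' = y then s else ⊤) ∈ F)
    {B : F → G} {C : G → F}
    (h : ∀ (f : F) (g : G), (B f : X → T) ≤ (g : X → T) ↔ (C g : Y → S) ≤ (f : Y → S)) (f : F) :
    IsLeast {g : X → T | g ∈ G ∧ ∀ (y : Y) (x : X),
      (B ⟨fun y' => if y' = y then (f : Y → S) y else ⊤, hFdirac y _⟩ : X → T) x ≤ g x}
      (B f : X → T) := by
  refine ⟨⟨(B f).2, fun y => ?_⟩, fun g hg => ?_⟩
  · exact (h _ (B f)).2 (((h f (B f)).1 le_rfl).trans ((le_dirac_iff _ y _).2 le_rfl))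
  · refine (h f ⟨g, hg.1⟩).2 fun y => ?_
    exact (le_dirac_iff _ y _).1 ((h _ ⟨g, hg.1⟩).1 (hg.2 y))

/-- A kernel representing `B` is the image under `B` of the Dirac functions. -/
theorem kernel_eq_apply_dirac {S T X Y : Type*} [Lattice S] [Lattice T] [OrderTop S]
    [DecidableEq Y] {F : Set (Y → S)} {G : Set (X → T)}
    (hFdirac : ∀ (y : Y) (s : S), (fun y' => if y' = y then s else ⊤) ∈ F)
    {B : F → G} {b : X → Y → S → T}
    (hb_top : ∀ (x : X) (y : Y) (t : T), b x y ⊤ ≤ t)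
    (hbG : ∀ (y : Y) (s : S), (fun x => b x y s) ∈ G)
    (hB : ∀ f : F,
      IsLeast {g : X → T | g ∈ G ∧ ∀ (y : Y) (x : X), b x y ((f : Y → S) y) ≤ g x}
        (B f : X → T)) (y : Y) (s : S) :
    (fun x => b x y s) = (B ⟨fun y' => if y' = y then s else ⊤, hFdirac y s⟩ : X → T) := by
  have hleast := hB ⟨fun y' => if y' = y then s else ⊤, hFdirac y s⟩
  refine le_antisymm (fun x => by simpa using hleast.1.2 y x)
    (hleast.2 ⟨hbG y s, fun y' x => ?_⟩)
  by_cases hy : y' = y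
  · subst hy
    simp
  · simpa [hy] using hb_top x y' (b x y s)

theorem isLeast_le_iff {S T X Y : Type*} [Lattice T] {G : Set (X → T)} {b : X → Y → S → T}
    {f : Y → S} {u : X → T}
    (hu : IsLeast {g : X → T | g ∈ G ∧ ∀ (y : Y) (x : X), b x y (f y) ≤ g x} u)
    {g : X → T} (hg : g ∈ G) : u ≤ g ↔ ∀ (y : Y) (x : X), b x y (f y) ≤ g x :=
  ⟨fun h y x => (hu.1.2 y x).trans (h x), fun h => hu.2 ⟨hg, h⟩⟩


/-- Representation theorem for dual functional Galois connections
(Theorem of Akian–Gaubert–Kolokoltsov, `theo-rep`).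
`F ⊆ S^Y` and `G ⊆ T^X` are sublattices containing all Dirac functions;
`(B, C)` is a dual Galois connection iff it is represented by kernels `b, b°`
as in the statement, and in that case the kernels are uniquely determined:
`b(·,y,s) = B δ_y^s` and `b°(·,x,t) = C δ_x^t`. -/
theorem stmt0
    {S T X Y : Type*} [Lattice S] [Lattice T] [OrderTop S] [OrderTop T]
    [Nonempty X] [Nonempty Y] [DecidableEq X] [DecidableEq Y]
    (F : Set (Y → S)) (G : Set (X → T))
    (hFlat : ∀ f₁ ∈ F, ∀ f₂ ∈ F, f₁ ⊔ f₂ ∈ F ∧ f₁ ⊓ f₂ ∈ F)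
    (hGlat : ∀ g₁ ∈ G, ∀ g₂ ∈ G, g₁ ⊔ g₂ ∈ G ∧ g₁ ⊓ g₂ ∈ G)
    (hFdirac : ∀ (y : Y) (s : S), (fun y' => if y' = y then s else ⊤) ∈ F)
    (hGdirac : ∀ (x : X) (t : T), (fun x' => if x' = x then t else ⊤) ∈ G)
    (B : F → G) (C : G → F) :
    ((∀ (f : F) (g : G), (B f : X → T) ≤ (g : X → T) ↔ (C g : Y → S) ≤ (f : Y → S)) ↔
      ∃ (b : X → Y → S → T) (bo : Y → X → T → S),
        (∀ (x : X) (y : Y) (s : S) (t : T), b x y s ≤ t ↔ bo y x t ≤ s) ∧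
        (∀ (x : X) (t : T), (fun y => bo y x t) ∈ F) ∧
        (∀ (y : Y) (s : S), (fun x => b x y s) ∈ G) ∧
        (∀ f : F,
          IsLeast {g : X → T | g ∈ G ∧ ∀ (y : Y) (x : X), b x y ((f : Y → S) y) ≤ g x}
            (B f : X → T)) ∧
        (∀ g : G,
          IsLeast {f : Y → S | f ∈ F ∧ ∀ (x : X) (y : Y), bo y x ((g : X → T) x) ≤ f y}
            (C g : Y → S))) ∧
    (∀ (b : X → Y → S → T) (bo : Y → X → T → S),
        (∀ (x : X) (y : Y) (s : S) (t : T), b x y s ≤ t ↔ bo y x t ≤ s) →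
        (∀ (x : X) (t : T), (fun y => bo y x t) ∈ F) →
        (∀ (y : Y) (s : S), (fun x => b x y s) ∈ G) →
        (∀ f : F,
          IsLeast {g : X → T | g ∈ G ∧ ∀ (y : Y) (x : X), b x y ((f : Y → S) y) ≤ g x}
            (B f : X → T)) →
        (∀ g : G,
          IsLeast {f : Y → S | f ∈ F ∧ ∀ (x : X) (y : Y), bo y x ((g : X → T) x) ≤ f y}
            (C g : Y → S)) →
        (∀ (y : Y) (s : S),
          (fun x => b x y s) =
            ((B ⟨fun y' => if y' = y then s else ⊤, hFdirac y s⟩ : G) : X → T)) ∧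
        (∀ (x : X) (t : T),
          (fun y => bo y x t) =
            ((C ⟨fun x' => if x' = x then t else ⊤, hGdirac x t⟩ : F) : Y → S))) := by
  refine ⟨⟨fun h => ?_, ?_⟩, ?_⟩
  · refine ⟨fun x y s => (B ⟨_, hFdirac y s⟩ : X → T) x, fun y x t => (C ⟨_, hGdirac x t⟩ : Y → S) y,
      fun x y s t => ?_, fun x t => (C _).2, fun y s => (B _).2,
      isLeast_of_dualGalois hFdirac h,
      isLeast_of_dualGalois hGdirac fun g f => (h f g).symm⟩
    exact (le_dirac_iff _ x t).symm.trans
      ((h ⟨_, hFdirac y s⟩ ⟨_, hGdirac x t⟩).trans (le_dirac_iff _ y s))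
  · rintro ⟨b, bo, hbbo, -, -, hB, hC⟩ f g
    rw [isLeast_le_iff (hB f) g.2, isLeast_le_iff (hC g) f.2, forall_comm]
    simp only [hbbo]
  · intro b bo hbbo hboF hbG hB hC
    exact ⟨kernel_eq_apply_dirac hFdirac (fun x y t => (hbbo x y ⊤ t).2 le_top) hbG hB,
      kernel_eq_apply_dirac hGdirac (fun y x s => (hbbo x y s ⊤).1 le_top) hboF hC⟩
end

section
/- A pair of maps (B : F → G, C : G → F) is a Galois connection between F and G (i.e. for all F ∈ F and G ∈ G: G ⊆ B(F) ⟺ F ⊆ C(G)) if, and only if, there exists a set ℬ ⊆ X × Y such that: for all x ∈ X, ℬ_x = {y ∈ Y : (x,y) ∈ ℬ} ∈ F; for all y ∈ Y, ℬ^y = {x ∈ X : (x,y) ∈ ℬ} ∈ G; for every F ∈ F, the greatest lower bound in G of the family {ℬ^y : y ∈ F} exists and equals B(F); and for every G ∈ G, the greatest lower bound in F of the family {ℬ_x : x ∈ G} exists and equals C(G). In this case ℬ is uniquely determined by (B,C): ℬ = ∪_{y∈Y} B({y}) × {y} = ∪_{x∈X} {x} × C({x}). -/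
/-- Representation of Galois connections between lattices of subsets
(Corollary `galois-ens`): `(B, C)` is a Galois connection between `F ⊆ P(Y)`
and `G ⊆ P(X)` iff it is represented by a relation `ℬ ⊆ X × Y`, and in that
case `ℬ = ⋃_{y} B({y}) × {y} = ⋃_{x} {x} × C({x})`. -/
theorem stmt2 {X Y : Type*} [Nonempty X] [Nonempty Y]
    (F : Set (Set Y)) (G : Set (Set X))
    (hFlat : ∀ A ∈ F, ∀ A' ∈ F, A ∪ A' ∈ F ∧ A ∩ A' ∈ F)
    (hGlat : ∀ D ∈ G, ∀ D' ∈ G, D ∪ D' ∈ G ∧ D ∩ D' ∈ G)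
    (hFempty : (∅ : Set Y) ∈ F) (hGempty : (∅ : Set X) ∈ G)
    (hFsing : ∀ y : Y, ({y} : Set Y) ∈ F) (hGsing : ∀ x : X, ({x} : Set X) ∈ G)
    (B : F → G) (C : G → F) :
    ((∀ (A : F) (D : G), (D : Set X) ⊆ (B A : Set X) ↔ (A : Set Y) ⊆ (C D : Set Y)) ↔
      ∃ ℬ : Set (X × Y),
        (∀ x : X, {y : Y | (x, y) ∈ ℬ} ∈ F) ∧
        (∀ y : Y, {x : X | (x, y) ∈ ℬ} ∈ G) ∧
        (∀ A : F,
          IsGreatest {D : Set X | D ∈ G ∧ ∀ y ∈ (A : Set Y), D ⊆ {x : X | (x, y) ∈ ℬ}}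
            (B A : Set X)) ∧
        (∀ D : G,
          IsGreatest {A : Set Y | A ∈ F ∧ ∀ x ∈ (D : Set X), A ⊆ {y : Y | (x, y) ∈ ℬ}}
            (C D : Set Y))) ∧
    (∀ ℬ : Set (X × Y),
        (∀ x : X, {y : Y | (x, y) ∈ ℬ} ∈ F) →
        (∀ y : Y, {x : X | (x, y) ∈ ℬ} ∈ G) →
        (∀ A : F,
          IsGreatest {D : Set X | D ∈ G ∧ ∀ y ∈ (A : Set Y), D ⊆ {x : X | (x, y) ∈ ℬ}}
            (B A : Set X)) →
        (∀ D : G,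
          IsGreatest {A : Set Y | A ∈ F ∧ ∀ x ∈ (D : Set X), A ⊆ {y : Y | (x, y) ∈ ℬ}}
            (C D : Set Y)) →
        ℬ = (⋃ y : Y, ((B ⟨{y}, hFsing y⟩ : G) : Set X) ×ˢ ({y} : Set Y)) ∧
        ℬ = (⋃ x : X, ({x} : Set X) ×ˢ ((C ⟨{x}, hGsing x⟩ : F) : Set Y))) := by
  refine ⟨⟨fun h => ?_, ?_⟩, fun ℬ hF hG hB hC => ⟨?_, ?_⟩⟩
  · have memB : ∀ (y : Y) (D : G),
        (D : Set X) ⊆ (B ⟨{y}, hFsing y⟩ : Set X) ↔ y ∈ (C D : Set Y) := fun y D =>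
      (h ⟨{y}, hFsing y⟩ D).trans Set.singleton_subset_iff
    have memC : ∀ (x : X) (A : F),
        x ∈ (B A : Set X) ↔ (A : Set Y) ⊆ (C ⟨{x}, hGsing x⟩ : Set Y) := fun x A =>
      Set.singleton_subset_iff.symm.trans (h A ⟨{x}, hGsing x⟩)
    have mem : ∀ (x : X) (y : Y), x ∈ (B ⟨{y}, hFsing y⟩ : Set X) ↔
        y ∈ (C ⟨{x}, hGsing x⟩ : Set Y) := fun x y =>
      (memC x _).trans Set.singleton_subset_iff
    refine ⟨{p | p.1 ∈ (B ⟨{p.2}, hFsing p.2⟩ : Set X)}, fun x => ?_,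
      fun y => (B ⟨{y}, hFsing y⟩).2, fun A => ⟨⟨(B A).2, fun y hy => ?_⟩, ?_⟩,
      fun D => ⟨⟨(C D).2, fun x hx y hy => ?_⟩, ?_⟩⟩
    · simp only [Set.mem_ofPred_eq, mem]
      exact (C ⟨{x}, hGsing x⟩).2
    · exact (memB y (B A)).2 ((h A (B A)).1 subset_rfl hy)
    · rintro D ⟨hD, hDA⟩
      exact (h A ⟨D, hD⟩).2 fun y hy => (memB y ⟨D, hD⟩).1 (hDA y hy)
    · exact (memB y D).2 hy hx
    · rintro A ⟨hA, hAD⟩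
      exact (h ⟨A, hA⟩ D).1 fun x hx =>
        (memC x ⟨A, hA⟩).2 fun y hy => (mem x y).1 (hAD x hx hy)
  · rintro ⟨ℬ, -, -, hB, hC⟩ A D
    exact ⟨fun h => (hC D).2 ⟨A.2, fun x hx y hy => (hB A).1.2 y hy (h hx)⟩,
      fun h => (hB A).2 ⟨D.2, fun y hy x hx => (hC D).1.2 x hx (h hy)⟩⟩
  · have hBy : ∀ y, (B ⟨{y}, hFsing y⟩ : Set X) = {x | (x, y) ∈ ℬ} := fun y =>
      ((hB ⟨{y}, hFsing y⟩).1.2 y rfl).antisymm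
        ((hB ⟨{y}, hFsing y⟩).2 ⟨hG y, by rintro _ rfl; rfl⟩)
    ext ⟨x, y⟩
    simp [hBy]
  · have hCx : ∀ x, (C ⟨{x}, hGsing x⟩ : Set Y) = {y | (x, y) ∈ ℬ} := fun x =>
      ((hC ⟨{x}, hGsing x⟩).1.2 x rfl).antisymm
        ((hC ⟨{x}, hGsing x⟩).2 ⟨hF x, by rintro _ rfl; rfl⟩)
    ext ⟨x, y⟩
    simp [hCx]
end

section
/- Let g ∈ G satisfy g = B(B°g). Then for every y ∈ Y, (∂°g)⁻¹(y) = ∂(B°g)(y). -/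
noncomputable def Bop {X Y : Type*} (b : X → Y → EReal → EReal) (f : Y → EReal) : X → EReal :=
  fun x => ⨆ y, b x y (f y)

noncomputable def Bgal {X Y : Type*} (bo : Y → X → EReal → EReal) (g : X → EReal) : Y → EReal :=
  fun y => ⨆ x, bo y x (g x)

/-- Subdifferential of `f` at `y` with respect to the kernel `b`. -/
def subdiff {X Y : Type*} (b : X → Y → EReal → EReal) (S : Set (X × Y))
    (f : Y → EReal) (y : Y) : Set X :=
  {x | (x, y) ∈ S ∧ Bop b f x = b x y (f y)}

/-- Subdifferential of `g` at `x` with respect to the kernel `b°`. -/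
def subdiffo {X Y : Type*} (bo : Y → X → EReal → EReal) (S : Set (X × Y))
    (g : X → EReal) (x : X) : Set Y :=
  {y | (x, y) ∈ S ∧ Bgal bo g y = bo y x (g x)}

/-- `(∂°g)⁻¹(y)`. -/
def subdiffoInv {X Y : Type*} (bo : Y → X → EReal → EReal) (S : Set (X × Y))
    (g : X → EReal) (y : Y) : Set X :=
  {x | y ∈ subdiffo bo S g x}

def ldom {Z : Type*} (h : Z → EReal) : Set Z := {z | h z < ⊤}
def udom {Z : Type*} (h : Z → EReal) : Set Z := {z | ⊥ < h z}
def edom {Z : Type*} (h : Z → EReal) : Set Z := ldom h ∩ udom h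
def idom {Z : Type*} [TopologicalSpace Z] (h : Z → EReal) : Set Z :=
  {z | z ∈ edom h ∧ Filter.limsup h (nhds z) < ⊤}

/-- `b` is continuous in the second variable. -/
def Cont2 {X Y : Type*} [TopologicalSpace Y] (b : X → Y → EReal → EReal) : Prop :=
  ∀ (x : X) (α : ℝ), Continuous fun y => b x y (α : EReal)

/-- `b` is coercive. -/
def Coercive {X Y : Type*} [TopologicalSpace X] [TopologicalSpace Y]
    (b : X → Y → EReal → EReal) (bo : Y → X → EReal → EReal) : Prop :=
  ∀ x : X, ∀ V ∈ nhds x, ∀ (α β : ℝ),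
    IsCompact (closure {y : Y | (⨆ z ∈ V, b z y (bo y x (α : EReal))) ≤ (β : EReal)})

/-- `f ∈ F_c`: relatively compact finite superlevel sets. -/
def MemFc {X Y : Type*} [TopologicalSpace Y] (b : X → Y → EReal → EReal)
    (f : Y → EReal) : Prop :=
  ∀ (x : X) (β : ℝ), IsCompact (closure {y : Y | (β : EReal) ≤ b x y (f y)})

/-- `f` solves Problem (P') for the data `g`, `X'`. -/
def IsSolution {X Y : Type*} [TopologicalSpace Y] (b : X → Y → EReal → EReal)
    (g : X → EReal) (X' : Set X) (f : Y → EReal) : Prop :=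
  LowerSemicontinuous f ∧ (∀ x, Bop b f x ≤ g x) ∧ ∀ x ∈ X', Bop b f x = g x

def SemiOpen {Z : Type*} [TopologicalSpace Z] (s : Set Z) : Prop :=
  s ⊆ closure (interior s)

def QuasiContinuous {Z W : Type*} [TopologicalSpace Z] [TopologicalSpace W]
    (h : Z → W) : Prop :=
  ∀ G : Set W, IsOpen G → SemiOpen (h ⁻¹' G)

/-- `h` is quasi-continuous on its domain. -/
def QuasiContinuousOnDom {Z : Type*} [TopologicalSpace Z] (h : Z → EReal) : Prop :=
  QuasiContinuous fun z : edom h => h z.1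

/-- `y` is algebraically essential with respect to the covering of `W'` by `{Fm z}_{z ∈ Z'}`. -/
def AlgEssential {Z W : Type*} (Fm : Z → Set W) (Z' : Set Z) (W' : Set W) (y : Z) : Prop :=
  y ∈ Z' ∧ ∃ w ∈ W', ∀ z ∈ Z' \ {y}, w ∉ Fm z

/-- `y` is topologically essential with respect to the covering of `W'` by `{Fm z}_{z ∈ Z'}`. -/
def TopEssential {Z W : Type*} [TopologicalSpace Z] (Fm : Z → Set W) (Z' : Set Z)
    (W' : Set W) (y : Z) : Prop :=
  y ∈ Z' ∧ ∀ U : Set Z, IsOpen U → y ∈ U → ∃ w ∈ W', ∀ z ∈ Z' \ U, w ∉ Fm z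

/-- A surjective kernel satisfying the Galois relation is a left inverse of its adjoint. -/
theorem apply_adjoint_of_surjective {α β : Type*} [Preorder α] [PartialOrder β]
    {u : α → β} {v : β → α} (h : ∀ a c, u a ≤ c ↔ v c ≤ a) (hu : Function.Surjective u) (c : β) :
    u (v c) = c := by
  refine le_antisymm ((h _ _).2 le_rfl) ?_
  obtain ⟨a, rfl⟩ := hu c
  exact (h _ _).2 (((h _ _).1 le_rfl).trans ((h _ _).1 le_rfl))

/-- If `g = B(B°g)`, then `(∂°g)⁻¹ = ∂(B°g)`. -/
theorem stmt4
    {X Y : Type*} [TopologicalSpace X] [TopologicalSpace Y] [T2Space X] [T2Space Y]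
    (b : X → Y → EReal → EReal) (bo : Y → X → EReal → EReal) (S : Set (X × Y))
    (hgal : ∀ (x : X) (y : Y) (α β : EReal), b x y α ≤ β ↔ bo y x β ≤ α)
    (hbo_lsc : ∀ (x : X) (α : EReal), LowerSemicontinuous fun y => bo y x α)
    (hS1 : ∀ x : X, ∃ y : Y, (x, y) ∈ S)
    (hS2 : ∀ y : Y, ∃ x : X, (x, y) ∈ S)
    (hS3 : ∀ x y, (x, y) ∈ S → Function.Bijective (b x y))
    (hS4 : ∀ x y, (x, y) ∉ S → ∀ α : EReal, b x y α = ⊥)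
    (g : X → EReal) (hg : g = Bop b (Bgal bo g)) :
    ∀ y : Y, subdiffoInv bo S g y = subdiff b S (Bgal bo g) y := by
  intro y
  ext x
  refine and_congr_right fun hxy => ?_
  rw [← hg]
  have hinv := apply_adjoint_of_surjective (hgal x y) (hS3 x y hxy).surjective (g x)
  constructor
  · intro h
    rw [h, hinv]
  · intro h
    exact (hS3 x y hxy).injective (h.symm.trans hinv.symm)
end

section
/- Let g ∈ G and X' ⊆ X. If ∂°g(x) ≠ ∅ for every x ∈ X', then f = B°g is a solution of Problem (P'): B(B°g) ≤ g everywhere and B(B°g)(x) = g(x) for all x ∈ X'. In particular, (P') has a solution. -/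
theorem Bop_Bgal_le {X Y : Type*} {b : X → Y → EReal → EReal} {bo : Y → X → EReal → EReal}
    (hgal : ∀ (x : X) (y : Y) (α β : EReal), b x y α ≤ β ↔ bo y x β ≤ α)
    (g : X → EReal) (x : X) : Bop b (Bgal bo g) x ≤ g x :=
  iSup_le fun y => (hgal x y _ _).2 (le_iSup (fun z => bo y z (g z)) x)

theorem le_Bop_Bgal_of_mem_subdiffo {X Y : Type*} {b : X → Y → EReal → EReal}
    {bo : Y → X → EReal → EReal} {S : Set (X × Y)}
    (hgal : ∀ (x : X) (y : Y) (α β : EReal), b x y α ≤ β ↔ bo y x β ≤ α)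
    (hsurj : ∀ x y, (x, y) ∈ S → Function.Surjective (b x y))
    {g : X → EReal} {x : X} {y : Y} (hy : y ∈ subdiffo bo S g x) :
    g x ≤ Bop b (Bgal bo g) x := by
  obtain ⟨hxy, heq⟩ := hy
  obtain ⟨α, hα⟩ := hsurj x y hxy (g x)
  have hle : Bgal bo g y ≤ α := heq ▸ (hgal x y _ _).1 hα.le
  calc g x = b x y α := hα.symm
    _ ≤ b x y (Bgal bo g y) := (hgal x y _ _).2 (((hgal x y _ _).1 le_rfl).trans hle)
    _ ≤ Bop b (Bgal bo g) x := le_iSup (fun z => b x z (Bgal bo g z)) y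

/-- If `∂°g(x) ≠ ∅` for all `x ∈ X'`, then `f = B°g` solves Problem (P'). -/
theorem stmt5
    {X Y : Type*} [TopologicalSpace X] [TopologicalSpace Y] [T2Space X] [T2Space Y]
    (b : X → Y → EReal → EReal) (bo : Y → X → EReal → EReal) (S : Set (X × Y))
    (hgal : ∀ (x : X) (y : Y) (α β : EReal), b x y α ≤ β ↔ bo y x β ≤ α)
    (hbo_lsc : ∀ (x : X) (α : EReal), LowerSemicontinuous fun y => bo y x α)
    (hS1 : ∀ x : X, ∃ y : Y, (x, y) ∈ S)
    (hS2 : ∀ y : Y, ∃ x : X, (x, y) ∈ S)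
    (hS3 : ∀ x y, (x, y) ∈ S → Function.Bijective (b x y))
    (hS4 : ∀ x y, (x, y) ∉ S → ∀ α : EReal, b x y α = ⊥)
    (g : X → EReal) (X' : Set X)
    (hne : ∀ x ∈ X', (subdiffo bo S g x).Nonempty) :
    IsSolution b g X' (Bgal bo g) := by
  refine ⟨lowerSemicontinuous_iSup fun x => hbo_lsc x (g x), Bop_Bgal_le hgal g, fun x hx => ?_⟩
  obtain ⟨y, hy⟩ := hne x hx
  exact (Bop_Bgal_le hgal g x).antisymm
    (le_Bop_Bgal_of_mem_subdiffo hgal (fun x y h => (hS3 x y h).surjective) hy)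
end

section
/- Let g ∈ G and X' ⊆ X. Consider the conditions: (c0) ∂°g(x) ≠ ∅ for all x ∈ X'; (c1) {(∂°g)⁻¹(y)}_{y∈Y} is a covering of X'; (c2) {(∂°g)⁻¹(y)}_{y∈ldom(B°g)} is a covering of X' ∩ udom g; (c3) {(∂°g)⁻¹(y)}_{y∈dom(B°g)} is a covering of X' ∩ dom g. Then (c0) ⟺ (c1) ⟺ (c2), (c2) ⇒ (c3), and if X' ⊆ idom g ∪ g⁻¹(−∞) then (c3) ⇒ (c2). -/
/-- A residuated bijective kernel has a residual that sends only `⊥` to `⊤`. -/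
theorem residual_eq_top_iff {u v : EReal → EReal} (h : ∀ α β, u α ≤ β ↔ v β ≤ α)
    (hu : Function.Bijective u) (β : EReal) : v β = ⊤ ↔ β = ⊥ := by
  have hle : ∀ γ, u ⊤ ≤ γ := fun γ => (h ⊤ γ).2 le_top
  have htop : u ⊤ = ⊥ := le_bot_iff.1 (hle ⊥)
  constructor
  · intro hv
    obtain ⟨α, rfl⟩ := hu.2 β
    have hα : v (u α) ≤ α := (h α (u α)).1 le_rfl
    rw [hv, top_le_iff] at hα
    rw [hα, htop]
  · rintro rfl
    have hb : u (v ⊥) = ⊥ := le_bot_iff.1 ((h (v ⊥) ⊥).2 le_rfl)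
    exact hu.1 (hb.trans htop.symm)

/-- A residuated bijective kernel has a residual that sends nothing but `⊤` to `⊥`. -/
theorem eq_top_of_residual_eq_bot {u v : EReal → EReal} (h : ∀ α β, u α ≤ β ↔ v β ≤ α)
    (hu : Function.Bijective u) {β : EReal} (hv : v β = ⊥) : β = ⊤ := by
  obtain ⟨α, hα⟩ := hu.2 ⊤
  have hβ : u ⊥ ≤ β := (h ⊥ β).2 hv.le
  have hanti : u α ≤ u ⊥ :=
    (h α (u ⊥)).2 (((h ⊥ (u ⊥)).1 le_rfl).trans bot_le)
  rw [hα] at hanti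
  exact top_le_iff.1 (hanti.trans hβ)

/-- Equivalences between the covering conditions (c0)-(c3). -/
theorem stmt6
    {X Y : Type*} [TopologicalSpace X] [TopologicalSpace Y] [T2Space X] [T2Space Y]
    (b : X → Y → EReal → EReal) (bo : Y → X → EReal → EReal) (S : Set (X × Y))
    (hgal : ∀ (x : X) (y : Y) (α β : EReal), b x y α ≤ β ↔ bo y x β ≤ α)
    (hbo_lsc : ∀ (x : X) (α : EReal), LowerSemicontinuous fun y => bo y x α)
    (hS1 : ∀ x : X, ∃ y : Y, (x, y) ∈ S)
    (hS2 : ∀ y : Y, ∃ x : X, (x, y) ∈ S)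
    (hS3 : ∀ x y, (x, y) ∈ S → Function.Bijective (b x y))
    (hS4 : ∀ x y, (x, y) ∉ S → ∀ α : EReal, b x y α = ⊥)
    (g : X → EReal) (X' : Set X) :
    ((∀ x ∈ X', (subdiffo bo S g x).Nonempty) ↔
        X' ⊆ ⋃ y : Y, subdiffoInv bo S g y) ∧
    ((X' ⊆ ⋃ y : Y, subdiffoInv bo S g y) ↔
        X' ∩ udom g ⊆ ⋃ y ∈ ldom (Bgal bo g), subdiffoInv bo S g y) ∧
    ((X' ∩ udom g ⊆ ⋃ y ∈ ldom (Bgal bo g), subdiffoInv bo S g y) →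
        X' ∩ edom g ⊆ ⋃ y ∈ edom (Bgal bo g), subdiffoInv bo S g y) ∧
    (X' ⊆ idom g ∪ {x | g x = ⊥} →
      (X' ∩ edom g ⊆ ⋃ y ∈ edom (Bgal bo g), subdiffoInv bo S g y) →
        X' ∩ udom g ⊆ ⋃ y ∈ ldom (Bgal bo g), subdiffoInv bo S g y) := by
  have htop : ∀ x y, (x, y) ∈ S → ∀ β, bo y x β = ⊤ ↔ β = ⊥ := fun x y hxy =>
    residual_eq_top_iff (hgal x y) (hS3 x y hxy)
  have hbot : ∀ x y, (x, y) ∈ S → ∀ β, bo y x β = ⊥ → β = ⊤ := fun x y hxy _ =>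
    eq_top_of_residual_eq_bot (hgal x y) (hS3 x y hxy)
  refine ⟨?_, ⟨?_, ?_⟩, ?_, ?_⟩
  · simp only [Set.subset_def, Set.mem_iUnion]
    exact Iff.rfl
  · rintro h x ⟨hx, hgx⟩
    obtain ⟨y, hS, hy⟩ := Set.mem_iUnion.1 (h hx)
    refine Set.mem_iUnion₂.2 ⟨y, show Bgal bo g y < ⊤ from (lt_top_iff_ne_top.2 fun e => ?_), hS, hy⟩
    exact (bot_lt_iff_ne_bot.1 hgx) ((htop x y hS _).1 (hy.symm.trans e))
  · intro h x hx
    by_cases hgx : g x = ⊥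
    · obtain ⟨y, hS⟩ := hS1 x
      have e : bo y x (g x) = ⊤ := (htop x y hS _).2 hgx
      have hle : bo y x (g x) ≤ Bgal bo g y := le_iSup (fun z => bo y z (g z)) x
      refine Set.mem_iUnion.2 ⟨y, hS, le_antisymm ?_ hle⟩
      rw [e]
      exact le_top
    · obtain ⟨y, -, hy⟩ := Set.mem_iUnion₂.1 (h ⟨hx, bot_lt_iff_ne_bot.2 hgx⟩)
      exact Set.mem_iUnion.2 ⟨y, hy⟩
  · rintro h x ⟨hx, hl, hu⟩
    obtain ⟨y, hyl, hS, hy⟩ := Set.mem_iUnion₂.1 (h ⟨hx, hu⟩)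
    refine Set.mem_iUnion₂.2 ⟨y, ⟨hyl, show ⊥ < Bgal bo g y from (bot_lt_iff_ne_bot.2 fun e => ?_)⟩, hS, hy⟩
    exact (lt_top_iff_ne_top.1 hl) (hbot x y hS _ (hy.symm.trans e))
  · rintro hX h x ⟨hx, hu⟩
    obtain hi | hi := hX hx
    · obtain ⟨y, hyd, hy⟩ := Set.mem_iUnion₂.1 (h ⟨hx, hi.1⟩)
      exact Set.mem_iUnion₂.2 ⟨y, hyd.1, hy⟩
    · exact absurd hi (bot_lt_iff_ne_bot.1 hu)
end

section
/- Let g ∈ G and X' ⊆ X. Assume: (a) either Y is discrete, or b is continuous in the second variable and B°g(y) > −∞ for all y ∈ Y; and (b) either B°g ∈ F_c, or b is coercive and X' ⊆ idom g ∪ g⁻¹(−∞). If Problem (P') has a solution, then {(∂°g)⁻¹(y)}_{y∈ldom(B°g)} is a covering of X' ∩ udom g. -/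
theorem antitone_of_galois {φ ψ : EReal → EReal}
    (hgal : ∀ α β, φ α ≤ β ↔ ψ β ≤ α) : Antitone φ :=
  fun _ _ h => (hgal _ _).2 (((hgal _ _).1 le_rfl).trans h)

/-- If `φ` and `ψ` form an antitone Galois connection and `φ` is surjective, then `ψ` is a right
inverse of `φ`. -/
theorem apply_of_galois_of_surjective {φ ψ : EReal → EReal}
    (hgal : ∀ α β, φ α ≤ β ↔ ψ β ≤ α) (hφ : Function.Surjective φ) (β : EReal) :
    φ (ψ β) = β := by
  obtain ⟨α, rfl⟩ := hφ β
  exact le_antisymm ((hgal _ _).2 le_rfl) (antitone_of_galois hgal ((hgal _ _).1 le_rfl))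

/-- An upper semicontinuous function with relatively compact finite superlevel sets attains its
supremum, provided the latter is not `⊥`. -/
theorem UpperSemicontinuous.exists_eq_iSup_of_isCompact_closure {Y : Type*} [TopologicalSpace Y]
    {F : Y → EReal} (hF : UpperSemicontinuous F)
    (hc : ∀ β : ℝ, IsCompact (closure {y | (β : EReal) ≤ F y})) (hbot : ⊥ < ⨆ y, F y) :
    ∃ y, F y = ⨆ y, F y := by
  obtain ⟨β, -, hβ⟩ := EReal.lt_iff_exists_real_btwn.1 hbot
  obtain ⟨y₁, hy₁⟩ := lt_iSup_iff.1 hβ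
  obtain ⟨y₀, -, hmax⟩ := (hF.upperSemicontinuousOn _).exists_isMaxOn
    ⟨y₁, subset_closure hy₁.le⟩ (hc β)
  refine ⟨y₀, le_antisymm (le_iSup F y₀) (iSup_le fun y => ?_)⟩
  rcases le_total (β : EReal) (F y) with h | h
  · exact hmax (subset_closure h)
  · exact h.trans (hy₁.le.trans (hmax (subset_closure hy₁.le)))

/-- Composing a kernel that is continuous in the second variable with a lower semicontinuous
function avoiding `⊥` gives an upper semicontinuous function. -/
theorem upperSemicontinuous_kernel_comp {Y : Type*} [TopologicalSpace Y]
    {φ : Y → EReal → EReal} {h : Y → EReal} (hanti : ∀ y, Antitone (φ y))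
    (hφ : ∀ y, Function.Bijective (φ y) ∨ ∀ α, φ y α = ⊥)
    (hcont : ∀ α : ℝ, Continuous fun y => φ y (α : EReal))
    (hh : LowerSemicontinuous h) (hbot : ∀ y, h y ≠ ⊥) :
    UpperSemicontinuous fun y => φ y (h y) := by
  intro y₀ β hβ
  obtain ⟨α, hα, hαβ⟩ : ∃ α : ℝ, (α : EReal) < h y₀ ∧ φ y₀ α < β := by
    rcases hφ y₀ with hbij | hconst
    · obtain ⟨β', h₁, h₂⟩ := exists_between hβ
      obtain ⟨α', rfl⟩ := hbij.2 β'
      have hlt : α' < h y₀ := by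
        by_contra! hle
        exact (hanti y₀ hle).not_gt h₁
      obtain ⟨α, hα', hα⟩ := EReal.lt_iff_exists_real_btwn.1 hlt
      exact ⟨α, hα, (hanti y₀ hα'.le).trans_lt h₂⟩
    · obtain ⟨α, -, hα⟩ := EReal.lt_iff_exists_real_btwn.1 (bot_lt_iff_ne_bot.2 (hbot y₀))
      exact ⟨α, hα, by simpa [hconst] using hβ⟩
  filter_upwards [hh y₀ α hα, (hcont α).continuousAt.eventually (eventually_lt_nhds hαβ)]
    with y h₁ h₂
  exact (hanti y h₁.le).trans_lt h₂

/-- If Problem (P') has a solution then, under the compactness/continuity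
assumptions, `{(∂°g)⁻¹(y)}_{y ∈ ldom(B°g)}` covers `X' ∩ udom g`. -/
theorem stmt7
    {X Y : Type*} [TopologicalSpace X] [TopologicalSpace Y] [T2Space X] [T2Space Y]
    (b : X → Y → EReal → EReal) (bo : Y → X → EReal → EReal) (S : Set (X × Y))
    (hgal : ∀ (x : X) (y : Y) (α β : EReal), b x y α ≤ β ↔ bo y x β ≤ α)
    (hbo_lsc : ∀ (x : X) (α : EReal), LowerSemicontinuous fun y => bo y x α)
    (hS1 : ∀ x : X, ∃ y : Y, (x, y) ∈ S)
    (hS2 : ∀ y : Y, ∃ x : X, (x, y) ∈ S)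
    (hS3 : ∀ x y, (x, y) ∈ S → Function.Bijective (b x y))
    (hS4 : ∀ x y, (x, y) ∉ S → ∀ α : EReal, b x y α = ⊥)
    (g : X → EReal) (X' : Set X)
    (ha : DiscreteTopology Y ∨ (Cont2 b ∧ ∀ y : Y, Bgal bo g y ≠ ⊥))
    (hb : MemFc b (Bgal bo g) ∨ (Coercive b bo ∧ X' ⊆ idom g ∪ {x | g x = ⊥}))
    (hsol : ∃ f : Y → EReal, IsSolution b g X' f) :
    X' ∩ udom g ⊆ ⋃ y ∈ ldom (Bgal bo g), subdiffoInv bo S g y := by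
  rintro x ⟨hxX', hgx⟩
  obtain ⟨f, -, hfg, hfX'⟩ := hsol
  set h := Bgal bo g
  have hanti : ∀ x y, Antitone (b x y) := fun x y => antitone_of_galois (hgal x y)
  have hbh : ∀ z y, b z y (h y) ≤ g z := fun z y =>
    (hgal _ _ _ _).2 (le_iSup (fun z => bo y z (g z)) z)
  have hhf : ∀ y, h y ≤ f y := fun y => iSup_le fun z =>
    (hgal _ _ _ _).1 ((le_iSup (fun y => b z y (f y)) y).trans (hfg z))
  have hsup : ⨆ y, b x y (h y) = g x :=
    le_antisymm (iSup_le (hbh x))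
      ((hfX' x hxX').symm.le.trans (iSup_mono fun y => hanti x y (hhf y)))
  have hinS : ∀ y α, b x y α ≠ ⊥ → (x, y) ∈ S := fun y α hne => by
    by_contra hn
    exact hne (hS4 x y hn α)
  have hinv : ∀ y, (x, y) ∈ S → ∀ β, b x y (bo y x β) = β := fun y hy =>
    apply_of_galois_of_surjective (hgal x y) (hS3 x y hy).2
  have husc : UpperSemicontinuous fun y => b x y (h y) := by
    rcases ha with hd | ⟨hcont, hbot⟩
    · exact (continuous_of_discreteTopology).upperSemicontinuous
    · refine upperSemicontinuous_kernel_comp (hanti x) (fun y => ?_) (hcont x) ?_ hbot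
      · by_cases hy : (x, y) ∈ S
        · exact Or.inl (hS3 x y hy)
        · exact Or.inr (hS4 x y hy)
      · exact lowerSemicontinuous_iSup fun z => hbo_lsc z (g z)
  have hcpt : ∀ β : ℝ, IsCompact (closure {y | (β : EReal) ≤ b x y (h y)}) := by
    rcases hb with hFc | ⟨hcoer, hdom⟩
    · exact hFc x
    · intro β
      obtain ⟨-, hlim⟩ : x ∈ idom g := (hdom hxX').resolve_right hgx.ne'
      obtain ⟨α, hα, -⟩ := EReal.lt_iff_exists_real_btwn.1 hlim
      refine (hcoer x _ (Filter.eventually_lt_of_limsup_lt hα) β α).of_isClosed_subset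
        isClosed_closure (closure_mono fun y hy => ?_)
      rw [Set.mem_ofPred_eq]
      refine iSup₂_le fun z hz => ?_
      have hy' : (β : EReal) ≤ b x y (h y) := hy
      have hyS : (x, y) ∈ S :=
        hinS y (h y) ((EReal.bot_lt_coe β).trans_le hy').ne'
      have hle : h y ≤ bo y x β := by
        by_contra! hlt
        have heq : b x y (h y) = b x y (bo y x β) :=
          le_antisymm (hanti x y hlt.le) ((hinv y hyS β).le.trans hy')
        exact hlt.ne' ((hS3 x y hyS).1 heq)
      exact (hanti z y hle).trans ((hbh z y).trans (le_of_lt hz))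
  obtain ⟨y, hy⟩ := husc.exists_eq_iSup_of_isCompact_closure hcpt (hsup.symm ▸ hgx)
  have hyg : b x y (h y) = g x := hy.trans hsup
  have hyS : (x, y) ∈ S := hinS y (h y) (hyg.trans_ne hgx.ne')
  refine Set.mem_iUnion₂.2 ⟨y, Ne.lt_top (a := h y) fun htop => ?_, hyS, ?_⟩
  · have hle : b x y ⊤ ≤ ⊥ := (hgal _ _ _ _).2 le_top
    rw [← htop, hyg] at hle
    exact hgx.not_ge hle
  · exact (hS3 x y hyS).1 (hyg.trans (hinv y hyS (g x)).symm)
end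

section
/- Assume Y is a finite set (with the discrete topology, so that F = ℝ̄^Y). Let g ∈ G. Then the equation Bf = g has a solution f ∈ F if, and only if, {(∂°g)⁻¹(y)}_{y∈Y} is a covering of X. -/
section GaloisKernel

variable {X Y : Type*} {b : X → Y → EReal → EReal} {bo : Y → X → EReal → EReal}

theorem kernel_antitone
    (hgal : ∀ (x : X) (y : Y) (α β : EReal), b x y α ≤ β ↔ bo y x β ≤ α) (x : X) (y : Y) :
    Antitone (b x y) := fun _ _ h =>
  (hgal x y _ _).2 (((hgal x y _ _).1 le_rfl).trans h)

theorem kernel_dual_of_surjective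
    (hgal : ∀ (x : X) (y : Y) (α β : EReal), b x y α ≤ β ↔ bo y x β ≤ α) {x : X} {y : Y}
    (hsurj : Function.Surjective (b x y)) (β : EReal) : b x y (bo y x β) = β := by
  obtain ⟨α, rfl⟩ := hsurj β
  exact le_antisymm ((hgal x y _ _).2 le_rfl)
    (kernel_antitone hgal x y ((hgal x y _ _).1 le_rfl))

theorem Bop_le_iff_Bgal_le
    (hgal : ∀ (x : X) (y : Y) (α β : EReal), b x y α ≤ β ↔ bo y x β ≤ α)
    (f : Y → EReal) (g : X → EReal) : Bop b f ≤ g ↔ Bgal bo g ≤ f := by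
  simp only [Pi.le_def, Bop, Bgal, iSup_le_iff, hgal]
  exact forall_comm

theorem exists_mem_Bop_eq [Finite Y] {S : Set (X × Y)} (hS1 : ∀ x : X, ∃ y : Y, (x, y) ∈ S)
    (hS4 : ∀ x y, (x, y) ∉ S → ∀ α : EReal, b x y α = ⊥) (f : Y → EReal) (x : X) :
    ∃ y, (x, y) ∈ S ∧ b x y (f y) = Bop b f x := by
  obtain ⟨y₀, hy₀⟩ := hS1 x
  have : Nonempty Y := ⟨y₀⟩
  obtain ⟨y, hy⟩ := exists_eq_ciSup_of_finite (f := fun y => b x y (f y))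
  by_cases hyS : (x, y) ∈ S
  · exact ⟨y, hyS, hy⟩
  · have hbot : Bop b f x = ⊥ := hy.symm.trans (hS4 x y hyS _)
    refine ⟨y₀, hy₀, le_antisymm (le_iSup (fun y => b x y (f y)) y₀) ?_⟩
    rw [hbot]
    exact bot_le

end GaloisKernel

/-- For finite `Y`, `Bf = g` has a solution iff `{(∂°g)⁻¹(y)}_{y∈Y}` covers `X`. -/
theorem stmt8
    {X Y : Type*} [TopologicalSpace X] [TopologicalSpace Y] [T2Space X] [T2Space Y]
    (b : X → Y → EReal → EReal) (bo : Y → X → EReal → EReal) (S : Set (X × Y))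
    (hgal : ∀ (x : X) (y : Y) (α β : EReal), b x y α ≤ β ↔ bo y x β ≤ α)
    (hbo_lsc : ∀ (x : X) (α : EReal), LowerSemicontinuous fun y => bo y x α)
    (hS1 : ∀ x : X, ∃ y : Y, (x, y) ∈ S)
    (hS2 : ∀ y : Y, ∃ x : X, (x, y) ∈ S)
    (hS3 : ∀ x y, (x, y) ∈ S → Function.Bijective (b x y))
    (hS4 : ∀ x y, (x, y) ∉ S → ∀ α : EReal, b x y α = ⊥)
    [Finite Y] [DiscreteTopology Y]
    (g : X → EReal) :
    (∃ f : Y → EReal, LowerSemicontinuous f ∧ Bop b f = g) ↔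
      (Set.univ : Set X) ⊆ ⋃ y : Y, subdiffoInv bo S g y := by
  constructor
  · rintro ⟨f, -, rfl⟩ x -
    obtain ⟨y, hyS, hy⟩ := exists_mem_Bop_eq hS1 hS4 f x
    have hf : bo y x (Bop b f x) = f y := (hS3 x y hyS).1 <|
      (kernel_dual_of_surjective hgal (hS3 x y hyS).2 _).trans hy.symm
    refine Set.mem_iUnion.2 ⟨y, hyS, le_antisymm ?_ (le_iSup (fun x => bo y x (Bop b f x)) x)⟩
    rw [hf]
    exact (Bop_le_iff_Bgal_le hgal f _).1 le_rfl y
  · intro hcov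
    refine ⟨Bgal bo g, continuous_of_discreteTopology.lowerSemicontinuous,
      le_antisymm ((Bop_le_iff_Bgal_le hgal _ g).2 le_rfl) fun x => ?_⟩
    obtain ⟨y, hyS, hy⟩ := Set.mem_iUnion.1 (hcov (Set.mem_univ x))
    calc g x = b x y (Bgal bo g y) := by
          rw [hy, kernel_dual_of_surjective hgal (hS3 x y hyS).2]
      _ ≤ Bop b (Bgal bo g) x := le_iSup (fun y => b x y (Bgal bo g y)) y
end

section
/- Let f ∈ F and g ∈ G with Bf ≤ g, and set E = {x ∈ X : Bf(x) = g(x)}. Then: (i) B(B°g)(x) = g(x) for all x ∈ E; (ii) for every y ∈ Y: if f(y) = B°g(y), then ∂f(y) ∩ E = ∂(B°g)(y) ∩ E = (∂°g)⁻¹(y); and if f(y) ≠ B°g(y), then ∂f(y) ∩ E = ∅. -/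
/-- An injective kernel section is left-inverted by its Galois dual. -/
theorem dual_kernel_apply_kernel {φ ψ : EReal → EReal} (hgal : ∀ α β, φ α ≤ β ↔ ψ β ≤ α)
    (hφ : Function.Injective φ) (α : EReal) : ψ (φ α) = α := by
  have hle : ψ (φ α) ≤ α := (hgal α (φ α)).1 le_rfl
  refine hφ (le_antisymm ?_ ?_)
  · exact (hgal _ _).2 le_rfl
  · exact (hgal _ _).2 (((hgal _ _).1 le_rfl).trans hle)

/-- Properties of subdifferentials on the coincidence set `E`. -/
theorem stmt10
    {X Y : Type*} [TopologicalSpace X] [TopologicalSpace Y] [T2Space X] [T2Space Y]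
    (b : X → Y → EReal → EReal) (bo : Y → X → EReal → EReal) (S : Set (X × Y))
    (hgal : ∀ (x : X) (y : Y) (α β : EReal), b x y α ≤ β ↔ bo y x β ≤ α)
    (hbo_lsc : ∀ (x : X) (α : EReal), LowerSemicontinuous fun y => bo y x α)
    (hS1 : ∀ x : X, ∃ y : Y, (x, y) ∈ S)
    (hS2 : ∀ y : Y, ∃ x : X, (x, y) ∈ S)
    (hS3 : ∀ x y, (x, y) ∈ S → Function.Bijective (b x y))
    (hS4 : ∀ x y, (x, y) ∉ S → ∀ α : EReal, b x y α = ⊥)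
    (f : Y → EReal) (hf : LowerSemicontinuous f)
    (g : X → EReal) (hle : ∀ x, Bop b f x ≤ g x) :
    (∀ x ∈ {x : X | Bop b f x = g x}, Bop b (Bgal bo g) x = g x) ∧
    (∀ y : Y,
      (f y = Bgal bo g y →
        subdiff b S f y ∩ {x : X | Bop b f x = g x} =
            subdiff b S (Bgal bo g) y ∩ {x : X | Bop b f x = g x} ∧
        subdiff b S f y ∩ {x : X | Bop b f x = g x} = subdiffoInv bo S g y) ∧
      (f y ≠ Bgal bo g y → subdiff b S f y ∩ {x : X | Bop b f x = g x} = ∅)) := by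
  
  have hBgal_le : ∀ y, Bgal bo g y ≤ f y := fun y =>
    iSup_le fun x => (hgal x y _ _).1 ((le_iSup (fun y => b x y (f y)) y).trans (hle x))
  have hdual_le : ∀ x y, bo y x (g x) ≤ Bgal bo g y := fun x y =>
    le_iSup (fun x => bo y x (g x)) x
  have hBop_Bgal : ∀ x, Bop b f x = g x → Bop b (Bgal bo g) x = g x := by
    intro x hx
    refine le_antisymm (iSup_le fun y => (hgal x y _ _).2 (hdual_le x y)) ?_
    rw [← hx]
    refine iSup_mono fun y => (hgal x y _ _).2 ?_
    exact ((hgal x y _ _).1 le_rfl).trans (hBgal_le y)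
  have hdual_eq : ∀ x y, x ∈ subdiff b S f y → Bop b f x = g x → bo y x (g x) = f y := by
    rintro x y ⟨hxy, hsub⟩ hx
    rw [← hx, hsub]
    exact dual_kernel_apply_kernel (hgal x y) (hS3 x y hxy).injective _
  refine ⟨hBop_Bgal, fun y => ⟨fun hy => ⟨?_, ?_⟩, fun hy => ?_⟩⟩
  · ext x
    refine and_congr_left fun hx => and_congr_right fun _ => ?_
    rw [hBop_Bgal x hx, hy, show Bop b f x = g x from hx]
  · ext x
    constructor
    · rintro ⟨hsub, hx⟩
      exact ⟨hsub.1, by rw [hdual_eq x y hsub hx, hy]⟩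
    · rintro ⟨hxy, hsub⟩
      have hb : b x y (f y) = g x := by
        obtain ⟨α, hα⟩ := (hS3 x y hxy).surjective (g x)
        rw [hy, hsub, ← hα, dual_kernel_apply_kernel (hgal x y) (hS3 x y hxy).injective]
      have hx : Bop b f x = g x :=
        le_antisymm (hle x) (hb.symm.le.trans (le_iSup (fun y => b x y (f y)) y))
      exact ⟨⟨hxy, hx.trans hb.symm⟩, hx⟩
  · refine Set.eq_empty_of_forall_notMem ?_
    rintro x ⟨hsub, hx⟩
    exact hy (le_antisymm ((hdual_eq x y hsub hx).symm.le.trans (hdual_le x y)) (hBgal_le y))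
end

section
/- Let Y be a topological space, let f : Y → ℝ̄ be lower semicontinuous, and let h : Y → ℝ̄ be quasi-continuous. Then the set V = {y ∈ Y : h(y) < f(y)} is semi-open. In particular, if V is nonempty then V has nonempty interior. -/
theorem SemiOpen.inter_isOpen {Z : Type*} [TopologicalSpace Z] {s u : Set Z}
    (hs : SemiOpen s) (hu : IsOpen u) : SemiOpen (s ∩ u) := by
  rintro z ⟨hzs, hzu⟩
  rw [interior_inter, hu.interior_eq]
  exact hu.closure_inter ⟨hs hzs, hzu⟩

theorem SemiOpen.of_forall_mem {Z : Type*} [TopologicalSpace Z] {s : Set Z}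
    (hs : ∀ z ∈ s, ∃ t ⊆ s, z ∈ t ∧ SemiOpen t) : SemiOpen s := by
  intro z hz
  obtain ⟨t, hts, hzt, ht⟩ := hs z hz
  exact closure_mono (interior_mono hts) (ht hzt)

theorem SemiOpen.interior_nonempty {Z : Type*} [TopologicalSpace Z] {s : Set Z}
    (hs : SemiOpen s) (hne : s.Nonempty) : (interior s).Nonempty :=
  closure_nonempty_iff.mp (hne.mono hs)

theorem QuasiContinuous.semiOpen_lt {Y α : Type*} [TopologicalSpace Y] [TopologicalSpace α]
    [LinearOrder α] [OrderTopology α] [DenselyOrdered α] {f h : Y → α}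
    (hh : QuasiContinuous h) (hf : LowerSemicontinuous f) : SemiOpen {y : Y | h y < f y} := by
  refine SemiOpen.of_forall_mem fun y hy => ?_
  obtain ⟨c, hhc, hcf⟩ := exists_between (show h y < f y from hy)
  exact ⟨h ⁻¹' Set.Iio c ∩ f ⁻¹' Set.Ioi c, fun x hx => lt_trans hx.1 hx.2, ⟨hhc, hcf⟩,
    (hh _ isOpen_Iio).inter_isOpen (hf.isOpen_preimage c)⟩

/-- If `f` is l.s.c. and `h` is quasi-continuous, then `{h < f}` is semi-open;
in particular if it is nonempty it has nonempty interior. -/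
theorem stmt12 {Y : Type*} [TopologicalSpace Y] (f h : Y → EReal)
    (hf : LowerSemicontinuous f) (hh : QuasiContinuous h) :
    SemiOpen {y : Y | h y < f y} ∧
    ({y : Y | h y < f y}.Nonempty → (interior {y : Y | h y < f y}).Nonempty) :=
  ⟨hh.semiOpen_lt hf, (hh.semiOpen_lt hf).interior_nonempty⟩
end

section
/- For every function f : ℝⁿ → ℝ̄, the Legendre–Fenchel conjugate f* is lower semicontinuous on ℝⁿ, and f* is quasi-continuous on its domain dom f* = {x ∈ ℝⁿ : f*(x) ∈ ℝ} (i.e. the restriction of f* to dom f*, with the subspace topology, is quasi-continuous). -/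
open RealInnerProductSpace

/-- Legendre–Fenchel conjugate of `f : ℝⁿ → ℝ̄`, with the convention that
`-∞` is absorbing for addition in `ℝ̄` (as in Mathlib's `EReal` addition). -/
noncomputable def fenchel {n : ℕ} (f : EuclideanSpace ℝ (Fin n) → EReal)
    (x : EuclideanSpace ℝ (Fin n)) : EReal :=
  ⨆ y : EuclideanSpace ℝ (Fin n), ((⟪x, y⟫ : ℝ) : EReal) + (- f y)

open Set Filter Topology

theorem continuous_coe_inner_add {n : ℕ} (y : EuclideanSpace ℝ (Fin n)) (c : EReal) :
    Continuous fun x : EuclideanSpace ℝ (Fin n) => ((⟪x, y⟫ : ℝ) : EReal) + c := by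
  induction c with
  | bot => simpa using continuous_const
  | top => simpa using continuous_const
  | coe c =>
    simp only [← EReal.coe_add]
    exact continuous_coe_real_ereal.comp (by fun_prop)

theorem lowerSemicontinuous_fenchel {n : ℕ} (f : EuclideanSpace ℝ (Fin n) → EReal) :
    LowerSemicontinuous (fenchel f) :=
  lowerSemicontinuous_iSup fun y => (continuous_coe_inner_add y (-f y)).lowerSemicontinuous

theorem fenchel_ne_bot {n : ℕ} {f : EuclideanSpace ℝ (Fin n) → EReal}
    {x : EuclideanSpace ℝ (Fin n)} (hx : fenchel f x ≠ ⊥) (z : EuclideanSpace ℝ (Fin n)) :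
    fenchel f z ≠ ⊥ := by
  contrapose! hx
  simp only [fenchel, iSup_eq_bot, EReal.add_eq_bot_iff, EReal.coe_ne_bot, false_or] at hx ⊢
  exact hx

theorem fenchel_convex_le {n : ℕ} (f : EuclideanSpace ℝ (Fin n) → EReal)
    {x y : EuclideanSpace ℝ (Fin n)} {r s a b : ℝ} (hx : fenchel f x ≤ r) (hy : fenchel f y ≤ s)
    (ha : 0 ≤ a) (hb : 0 ≤ b) (hab : a + b = 1) :
    fenchel f (a • x + b • y) ≤ ((a * r + b * s : ℝ) : EReal) := by
  refine iSup_le fun u => ?_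
  have h1 := (le_iSup (fun u => ((⟪x, u⟫ : ℝ) : EReal) + (-f u)) u).trans hx
  have h2 := (le_iSup (fun u => ((⟪y, u⟫ : ℝ) : EReal) + (-f u)) u).trans hy
  generalize -f u = c at h1 h2 ⊢
  induction c with
  | bot => simp
  | top => simp at h1
  | coe c =>
    simp only [← EReal.coe_add, EReal.coe_le_coe_iff] at h1 h2 ⊢
    rw [inner_add_left, real_inner_smul_left, real_inner_smul_left]
    have hc : c = a * c + b * c := by rw [← add_mul, hab, one_mul]
    nlinarith [mul_le_mul_of_nonneg_left h1 ha, mul_le_mul_of_nonneg_left h2 hb]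

theorem convexOn_toReal_fenchel {n : ℕ} (f : EuclideanSpace ℝ (Fin n) → EReal) :
    ConvexOn ℝ {x | fenchel f x ≠ ⊤ ∧ fenchel f x ≠ ⊥} fun x => (fenchel f x).toReal := by
  have key : ∀ ⦃x⦄, x ∈ {x | fenchel f x ≠ ⊤ ∧ fenchel f x ≠ ⊥} →
      ∀ ⦃y⦄, y ∈ {x | fenchel f x ≠ ⊤ ∧ fenchel f x ≠ ⊥} → ∀ ⦃a b : ℝ⦄, 0 ≤ a → 0 ≤ b →
      a + b = 1 → fenchel f (a • x + b • y) ≤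
        ((a * (fenchel f x).toReal + b * (fenchel f y).toReal : ℝ) : EReal) :=
    fun x hx y hy a b ha hb hab => fenchel_convex_le f (EReal.le_coe_toReal hx.1)
      (EReal.le_coe_toReal hy.1) ha hb hab
  refine ⟨fun x hx y hy a b ha hb hab => ⟨?_, fenchel_ne_bot hx.2 _⟩,
    fun x hx y hy a b ha hb hab => ?_⟩
  · exact ((key hx hy ha hb hab).trans_lt (EReal.coe_lt_top _)).ne
  · exact EReal.toReal_le_toReal (key hx hy ha hb hab) (fenchel_ne_bot hx.2 _)
      (EReal.coe_ne_top _)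

theorem lowerSemicontinuousOn_toReal_fenchel {n : ℕ} (f : EuclideanSpace ℝ (Fin n) → EReal) :
    LowerSemicontinuousOn (fun x => (fenchel f x).toReal)
      {x | fenchel f x ≠ ⊤ ∧ fenchel f x ≠ ⊥} := by
  intro x hx r hr
  have hr' : (r : EReal) < fenchel f x := by
    rwa [← EReal.coe_toReal hx.1 hx.2, EReal.coe_lt_coe_iff]
  filter_upwards [self_mem_nhdsWithin,
    nhdsWithin_le_nhds (lowerSemicontinuous_fenchel f x r hr')] with y hy hry
  rwa [← EReal.coe_toReal hy.1 hy.2, gt_iff_lt, EReal.coe_lt_coe_iff] at hry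

/-- A lower semicontinuous convex function is continuous along segments ending in its domain. -/
theorem ConvexOn.tendsto_segment_of_lowerSemicontinuousOn {V : Type*} [AddCommGroup V]
    [Module ℝ V] [TopologicalSpace V] [ContinuousAdd V] [ContinuousSMul ℝ V] {C : Set V}
    {h : V → ℝ} (hc : ConvexOn ℝ C h) (hl : LowerSemicontinuousOn h C) {v w : V} (hv : v ∈ C)
    (hw : w ∈ C) :
    Tendsto (fun t : ℝ => h ((1 - t) • v + t • w)) (𝓝[>] 0) (𝓝 (h v)) := by
  have hIoc : ∀ᶠ t : ℝ in 𝓝[>] 0, t ∈ Ioc (0 : ℝ) 1 := Ioc_mem_nhdsGT one_pos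
  have hseg : Tendsto (fun t : ℝ => (1 - t) • v + t • w) (𝓝[>] 0) (𝓝[C] v) := by
    refine tendsto_nhdsWithin_iff.2 ⟨?_, ?_⟩
    · have : Continuous fun t : ℝ => (1 - t) • v + t • w := by fun_prop
      simpa using (this.tendsto 0).mono_left nhdsWithin_le_nhds
    · filter_upwards [hIoc] with t ht
      exact hc.1 hv hw (by linarith [ht.2]) ht.1.le (by ring)
  refine tendsto_order.2 ⟨fun a ha => hseg.eventually (hl v hv a ha), fun a ha => ?_⟩
  have hup : Tendsto (fun t : ℝ => (1 - t) * h v + t * h w) (𝓝[>] 0) (𝓝 (h v)) := by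
    have : Continuous fun t : ℝ => (1 - t) * h v + t * h w := by fun_prop
    simpa using (this.tendsto 0).mono_left nhdsWithin_le_nhds
  filter_upwards [hup.eventually (gt_mem_nhds ha), hIoc] with t hta ht
  exact (hc.2 hv hw (by linarith [ht.2]) ht.1.le (by ring)).trans_lt hta

theorem ConvexOn.mem_closure_interior_inter_preimage {V : Type*} [AddCommGroup V]
    [Module ℝ V] [TopologicalSpace V] [IsTopologicalAddGroup V] [ContinuousSMul ℝ V] {C : Set V}
    {h : V → ℝ} (hc : ConvexOn ℝ C h) (hl : LowerSemicontinuousOn h C)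
    (hi : (interior C).Nonempty) {v : V} (hv : v ∈ C) {U : Set ℝ} (hU : IsOpen U)
    (hvU : h v ∈ U) : v ∈ closure (interior C ∩ h ⁻¹' U) := by
  obtain ⟨w, hw⟩ := hi
  have hseg : Tendsto (fun t : ℝ => (1 - t) • v + t • w) (𝓝[>] 0) (𝓝 v) := by
    have : Continuous fun t : ℝ => (1 - t) • v + t • w := by fun_prop
    simpa using (this.tendsto 0).mono_left nhdsWithin_le_nhds
  refine mem_closure_of_tendsto hseg ?_
  filter_upwards [Ioc_mem_nhdsGT (one_pos : (0 : ℝ) < 1),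
    (hc.tendsto_segment_of_lowerSemicontinuousOn hl hv (interior_subset hw)).eventually
      (hU.mem_nhds hvU)] with t ht htU
  exact ⟨hc.1.combo_self_interior_mem_interior hv hw (by linarith [ht.2]) ht.1 (by ring), htU⟩

/-- A convex set containing the origin has nonempty interior relative to its linear span. -/
theorem Convex.interior_preimage_span_nonempty {E : Type*} [NormedAddCommGroup E]
    [NormedSpace ℝ E] [FiniteDimensional ℝ E] {K : Set E} (hK : Convex ℝ K) (h0 : 0 ∈ K) :
    (interior ((↑) ⁻¹' K : Set (Submodule.span ℝ K))).Nonempty := by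
  have hconv : Convex ℝ ((↑) ⁻¹' K : Set (Submodule.span ℝ K)) :=
    hK.linear_preimage (Submodule.span ℝ K).subtype
  have h0' : (0 : Submodule.span ℝ K) ∈ ((↑) ⁻¹' K : Set (Submodule.span ℝ K)) := by simpa
  rw [hconv.interior_nonempty_iff_affineSpan_eq_top,
    AffineSubspace.affineSpan_eq_top_iff_vectorSpan_eq_top_of_nonempty _ _ _ ⟨0, h0'⟩,
    vectorSpan_eq_span_vsub_set_right ℝ h0']
  simp [Submodule.span_span_coe_preimage]

/-- A lower semicontinuous convex function on a finite-dimensional space is quasi-continuous on its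
domain. -/
theorem ConvexOn.quasiContinuous_domRestrict {E : Type*} [NormedAddCommGroup E]
    [NormedSpace ℝ E] [FiniteDimensional ℝ E] {D : Set E} {g : E → ℝ} (hc : ConvexOn ℝ D g)
    (hl : LowerSemicontinuousOn g D) : QuasiContinuous fun d : D => g d := by
  intro U hU z hz
  set K : Set E := (fun v => z.1 + v) ⁻¹' D with hKdef
  set V := Submodule.span ℝ K
  set φ : V → E := fun v => z.1 + v
  have hφ : Continuous φ := by fun_prop
  have hcK : ConvexOn ℝ K fun v => g (z.1 + v) := hc.translate_right z.1
  have hcC : ConvexOn ℝ (φ ⁻¹' D) (g ∘ φ) := hcK.comp_linearMap V.subtype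
  have h0 : (0 : E) ∈ K := by simp [hKdef]
  have hi : (interior (φ ⁻¹' D)).Nonempty := hcK.1.interior_preimage_span_nonempty h0
  have hlC : LowerSemicontinuousOn (g ∘ φ) (φ ⁻¹' D) :=
    hl.comp hφ.continuousOn (mapsTo_preimage φ D)
  have hmem : (0 : V) ∈ closure (interior (φ ⁻¹' D) ∩ (g ∘ φ) ⁻¹' U) :=
    hcC.mem_closure_interior_inter_preimage hlC hi (by simp [φ]) hU (by simpa [φ] using hz)
  have hopen : IsOpen (interior (φ ⁻¹' D) ∩ (g ∘ φ) ⁻¹' U) :=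
    hcC.continuousOn_interior.isOpen_inter_preimage isOpen_interior hU
  let ψ : D → V := fun d => ⟨d.1 - z.1, Submodule.subset_span (by simp [hKdef])⟩
  have hψ : Continuous ψ := by fun_prop
  have hφψ : ∀ d, φ (ψ d) = d := fun d => by simp [φ, ψ]
  have hsub : ψ ⁻¹' (interior (φ ⁻¹' D) ∩ (g ∘ φ) ⁻¹' U) ⊆ interior ((fun d : D => g d) ⁻¹' U) :=
    interior_maximal (fun d hd => by simpa [hφψ] using hd.2) (hopen.preimage hψ)
  refine closure_mono hsub (mem_closure_iff.2 fun O hO hzO => ?_)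
  obtain ⟨O', hO', rfl⟩ := isOpen_induced_iff.1 hO
  obtain ⟨w, hwO, hw⟩ := mem_closure_iff.1 hmem _ (hO'.preimage hφ) (by simpa [φ] using hzO)
  have hwD : φ w ∈ D := interior_subset (s := φ ⁻¹' D) hw.1
  refine ⟨⟨φ w, hwD⟩, hwO, ?_⟩
  have : ψ ⟨φ w, hwD⟩ = w := by ext1; simp [φ, ψ]
  rwa [mem_preimage, this]

/-- The Legendre–Fenchel transform on `ℝⁿ` is regular: `f*` is l.s.c. and
quasi-continuous on its domain `{x | f*(x) ∈ ℝ}`. -/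
theorem stmt16 {n : ℕ} (f : EuclideanSpace ℝ (Fin n) → EReal) :
    LowerSemicontinuous (fenchel f) ∧
    QuasiContinuous
      (fun z : {x : EuclideanSpace ℝ (Fin n) | fenchel f x ≠ ⊤ ∧ fenchel f x ≠ ⊥} =>
        fenchel f z.1) := by
  refine ⟨lowerSemicontinuous_fenchel f, fun G hG => ?_⟩
  convert (convexOn_toReal_fenchel f).quasiContinuous_domRestrict
    (lowerSemicontinuousOn_toReal_fenchel f) _ (hG.preimage continuous_coe_real_ereal) using 1
  ext z
  simp [EReal.coe_toReal z.2.1 z.2.2]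
end

section
/- Let g : ℝⁿ → ℝ̄ be an essentially smooth lower semicontinuous proper convex function. If f : ℝⁿ → ℝ̄ is lower semicontinuous and satisfies f* ≤ g everywhere and f*(x) = g(x) for all x in the interior of dom g, then f = g*. In particular, g has a unique lower semicontinuous preimage by the Legendre–Fenchel transform: if f is lower semicontinuous and f* = g, then f = g*. -/
open RealInnerProductSpace Filter

section InnerProduct

variable {E : Type*} [NormedAddCommGroup E] [InnerProductSpace ℝ E]

/-- The gradient of a convex function is a subgradient. -/
theorem ConvexOn.add_inner_le_of_hasGradientAt [CompleteSpace E] {S : Set E} {G : E → ℝ}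
    (hG : ConvexOn ℝ S G) {x z q : E} (hx : x ∈ S) (hz : z ∈ S) (hq : HasGradientAt G q x) :
    G x + ⟪q, z - x⟫ ≤ G z := by
  have hconv := hG.comp_affineMap (AffineMap.lineMap x z : ℝ →ᵃ[ℝ] E)
  have hline : HasDerivAt (AffineMap.lineMap x z : ℝ → E) (z - x) 0 :=
    AffineMap.hasDerivAt_lineMap
  have hd : HasDerivAt (G ∘ (AffineMap.lineMap x z : ℝ → E)) ⟪q, z - x⟫ 0 := by
    have hq' := hq.hasFDerivAt
    rw [← AffineMap.lineMap_apply_zero (k := ℝ) x z] at hq'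
    simpa using hq'.comp_hasDerivAt 0 hline
  have h := hconv.le_slope_of_hasDerivAt (x := 0) (y := 1) (by simpa using hx)
    (by simpa using hz) one_pos hd
  simp [slope_def_field] at h
  linarith

/-- At a point of differentiability, approximate subgradients are close to the gradient. -/
theorem HasGradientAt.exists_forall_norm_sub_le [CompleteSpace E] {S : Set E} {G : E → ℝ}
    {x q : E} (hq : HasGradientAt G q x) (hS : S ∈ nhds x) {η : ℝ} (hη : 0 < η) :
    ∃ ε > 0, ∀ y, (∀ z ∈ S, G x + ⟪y, z - x⟫ - ε ≤ G z) → ‖y - q‖ ≤ η := by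
  have h1 := (hasGradientAt_iff_isLittleO.1 hq).def (half_pos hη)
  obtain ⟨δ, hδ, hball⟩ := Metric.eventually_nhds_iff.1 (h1.and hS)
  refine ⟨η * δ / 4, by positivity, fun y hy => ?_⟩
  rcases eq_or_ne y q with rfl | hne
  · simpa using hη.le
  have hpos : 0 < ‖y - q‖ := norm_pos_iff.2 (sub_ne_zero.2 hne)
  have hnorm : ‖(δ / 2 / ‖y - q‖) • (y - q)‖ = δ / 2 := by
    rw [norm_smul, Real.norm_of_nonneg (by positivity)]
    field_simp
  obtain ⟨h2, h3⟩ := @hball (x + (δ / 2 / ‖y - q‖) • (y - q)) (by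
    rw [dist_eq_norm, add_sub_cancel_left, hnorm]; linarith)
  have h4 := hy _ h3
  rw [add_sub_cancel_left] at h2 h4
  rw [hnorm, Real.norm_eq_abs] at h2
  have h5 := (abs_le.1 h2).2
  have h6 : ⟪y, (δ / 2 / ‖y - q‖) • (y - q)⟫ - ⟪q, (δ / 2 / ‖y - q‖) • (y - q)⟫
      = δ / 2 * ‖y - q‖ := by
    rw [← inner_sub_left, inner_smul_right, real_inner_self_eq_norm_sq]
    field_simp
  have h7 : δ * ‖y - q‖ ≤ δ * η := by linarith
  exact le_of_mul_le_mul_left h7 hδ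

/-- If the gradients of a convex function blow up at the boundary of its domain, then every point
of the domain with a subgradient is an interior point. -/
theorem ConvexOn.mem_interior_of_subgradient [CompleteSpace E] {S : Set E} {G : E → ℝ}
    (hG : ConvexOn ℝ S G) (hS : (interior S).Nonempty)
    (hdiff : ∀ x ∈ interior S, DifferentiableAt ℝ G x)
    (hsteep : ∀ (u : ℕ → E) (x₀ : E), (∀ k, u k ∈ interior S) → x₀ ∈ frontier S →
      Tendsto u atTop (nhds x₀) → Tendsto (fun k => ‖gradient G (u k)‖) atTop atTop)
    {x q : E} (hx : x ∈ S) (hq : ∀ z ∈ S, G x + ⟪q, z - x⟫ ≤ G z) : x ∈ interior S := by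
  by_contra hxi
  obtain ⟨c, hc⟩ := hS
  have hev : ∀ᶠ z in nhds c, G z < G c + 1 ∧ z ∈ S :=
    ((hdiff c hc).continuousAt.eventually_lt continuousAt_const (lt_add_one _)).and
      (mem_interior_iff_mem_nhds.1 hc)
  obtain ⟨ρ, hρ, hball⟩ := Metric.eventually_nhds_iff.1 hev
  let t : ℕ → ℝ := fun k => 1 / ((k : ℝ) + 1)
  have ht : ∀ k, t k ∈ Set.Ioc (0 : ℝ) 1 := fun k => by
    have hk : (0 : ℝ) ≤ k := k.cast_nonneg
    exact ⟨by positivity, by rw [div_le_one (by positivity)]; linarith⟩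
  have hu : ∀ k, x + t k • (c - x) ∈ interior S := fun k =>
    hG.1.add_smul_sub_mem_interior hx hc (ht k)
  have hlim : Tendsto (fun k => x + t k • (c - x)) atTop (nhds x) := by
    have h := (tendsto_one_div_add_atTop_nhds_zero_nat (𝕜 := ℝ)).smul_const (c - x)
    simpa only [zero_smul, add_zero] using h.const_add x
  have htop := hsteep _ x hu ⟨subset_closure hx, hxi⟩ hlim
  obtain ⟨k, hk⟩ := (htop.eventually_gt_atTop
    ((G c + 1 - G x - ⟪q, c - x⟫ ) / (ρ / 2) ⊔ 0)).exists
  obtain ⟨hk1, hk0⟩ := max_lt_iff.1 hk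
  set p := gradient G (x + t k • (c - x)) with hp
  have hgrad := (hdiff _ (hu k)).hasGradientAt
  rw [← hp] at hgrad
  have hnorm : ‖(ρ / 2 / ‖p‖) • p‖ = ρ / 2 := by
    rw [norm_smul, Real.norm_of_nonneg (by positivity)]
    field_simp
  obtain ⟨hz1, hz2⟩ := @hball (c + (ρ / 2 / ‖p‖) • p) (by
    rw [dist_eq_norm, add_sub_cancel_left, hnorm]; linarith)
  have h1 := hG.add_inner_le_of_hasGradientAt (interior_subset (hu k)) hx hgrad
  have h2 := hq _ (interior_subset (hu k))
  have h3 := hG.add_inner_le_of_hasGradientAt (interior_subset (hu k)) hz2 hgrad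
  have e1 : x - (x + t k • (c - x)) = -(t k • (c - x)) := by abel
  have e3 : c + (ρ / 2 / ‖p‖) • p - (x + t k • (c - x))
      = (1 - t k) • (c - x) + (ρ / 2 / ‖p‖) • p := by
    rw [sub_smul, one_smul]; abel
  have e4 : ⟪p, (ρ / 2 / ‖p‖) • p⟫ = ρ / 2 * ‖p‖ := by
    rw [inner_smul_right, real_inner_self_eq_norm_sq]
    field_simp
  rw [e1, inner_neg_right, inner_smul_right] at h1
  rw [add_sub_cancel_left, inner_smul_right] at h2
  rw [e3, inner_add_right, inner_smul_right, e4] at h3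
  rw [div_lt_iff₀ (by positivity)] at hk1
  obtain ⟨ht0, ht1⟩ := ht k
  have h4 : ⟪q, c - x⟫ ≤ ⟪p, c - x⟫ := by
    refine le_of_mul_le_mul_left ?_ ht0
    linarith
  have h5 : (1 - t k) * ⟪q, c - x⟫ ≤ (1 - t k) * ⟪p, c - x⟫ :=
    mul_le_mul_of_nonneg_left h4 (by linarith)
  linarith

/-- First-order optimality for the sum of a convex function and a quadratic. -/
theorem ConvexOn.subgradient_of_isMin_add_quadratic {S : Set E} {G : E → ℝ}
    (hG : ConvexOn ℝ S G) {x y : E} {ε : ℝ} (hx : x ∈ S)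
    (hmin : ∀ z ∈ S, G x + (ε / 2 * ‖x‖ ^ 2 - ⟪x, y⟫) ≤ G z + (ε / 2 * ‖z‖ ^ 2 - ⟪z, y⟫)) :
    ∀ z ∈ S, G x + ⟪y - ε • x, z - x⟫ ≤ G z := by
  intro z hz
  have key : ∀ t ∈ Set.Ioo (0 : ℝ) 1,
      ⟪y, z - x⟫ - ε * ⟪x, z - x⟫ - t * (ε / 2 * ‖z - x‖ ^ 2) ≤ G z - G x := by
    intro t ht
    have hmem : x + t • (z - x) ∈ S := hG.1.add_smul_sub_mem hx hz ⟨ht.1.le, ht.2.le⟩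
    have h1 := hmin _ hmem
    have h2 := hG.2 hx hz (sub_nonneg.2 ht.2.le) ht.1.le (sub_add_cancel 1 t)
    have e : (1 - t) • x + t • z = x + t • (z - x) := by module
    rw [e, smul_eq_mul, smul_eq_mul] at h2
    rw [norm_add_sq_real, norm_smul, Real.norm_of_nonneg ht.1.le, inner_smul_right,
      inner_add_left, real_inner_smul_left, real_inner_comm y (z - x)] at h1
    refine le_of_mul_le_mul_left ?_ ht.1
    linarith
  have hlim : Tendsto (fun t : ℝ => ⟪y, z - x⟫ - ε * ⟪x, z - x⟫ - t * (ε / 2 * ‖z - x‖ ^ 2))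
      (nhdsWithin 0 (Set.Ioi 0))
      (nhds (⟪y, z - x⟫ - ε * ⟪x, z - x⟫ - 0 * (ε / 2 * ‖z - x‖ ^ 2))) :=
    (Continuous.tendsto (by fun_prop) _).mono_left nhdsWithin_le_nhds
  have h := le_of_tendsto hlim
    (Filter.mem_of_superset (Ioo_mem_nhdsGT (zero_lt_one' ℝ)) key)
  rw [inner_sub_left, real_inner_smul_left]
  linarith

/-- A lower semicontinuous function dominating a linear function up to a constant attains its
minimum after subtracting that linear function and adding a quadratic. -/
theorem LowerSemicontinuous.exists_isMin_add_quadratic [ProperSpace E] {g : E → EReal}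
    (hg : LowerSemicontinuous g) (hbot : ∀ x, g x ≠ ⊥) (htop : ∃ x, g x ≠ ⊤) {y : E} {C ε : ℝ}
    (hC : ∀ z, g z ≠ ⊤ → ⟪z, y⟫ - (g z).toReal ≤ C) (hε : 0 < ε) :
    ∃ x, g x ≠ ⊤ ∧ ∀ z, g z ≠ ⊤ →
      (g x).toReal + (ε / 2 * ‖x‖ ^ 2 - ⟪x, y⟫) ≤ (g z).toReal + (ε / 2 * ‖z‖ ^ 2 - ⟪z, y⟫) := by
  obtain ⟨c, hc⟩ := htop
  set φ : E → EReal := fun z => g z + ((ε / 2 * ‖z‖ ^ 2 - ⟪z, y⟫ : ℝ) : EReal) with hφ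
  have hφl : LowerSemicontinuous φ := by
    refine hg.add' ?_ fun x => EReal.continuousAt_add (Or.inr (EReal.coe_ne_bot _))
      (Or.inl (hbot x))
    exact (continuous_coe_real_ereal.comp (by fun_prop)).lowerSemicontinuous
  have hφr : ∀ z, g z ≠ ⊤ → φ z = (((g z).toReal + (ε / 2 * ‖z‖ ^ 2 - ⟪z, y⟫) : ℝ) : EReal) := by
    intro z hz
    rw [EReal.coe_add, EReal.coe_toReal hz (hbot z)]
  set K : ℝ := (g c).toReal + (ε / 2 * ‖c‖ ^ 2 - ⟪c, y⟫) + C with hK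
  have hK0 : 0 ≤ K := by
    have := hC c hc
    have : 0 ≤ ε / 2 * ‖c‖ ^ 2 := by positivity
    linarith
  set R : ℝ := ‖c‖ + 2 * K / ε + 1 with hR
  have hcR : c ∈ Metric.closedBall (0 : E) R := by
    rw [mem_closedBall_zero_iff]
    have : 0 ≤ 2 * K / ε := by positivity
    linarith
  obtain ⟨x, hxR, hx⟩ := LowerSemicontinuousOn.exists_isMinOn ⟨c, hcR⟩
    (isCompact_closedBall (0 : E) R) (hφl.lowerSemicontinuousOn _)
  have hxc : φ x ≤ φ c := hx hcR
  have hxt : g x ≠ ⊤ := by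
    intro h
    rw [hφr c hc, hφ] at hxc
    simp only [h, EReal.top_add_coe] at hxc
    exact EReal.coe_ne_top _ (top_le_iff.1 hxc)
  refine ⟨x, hxt, fun z hz => ?_⟩
  rw [hφr c hc, hφr x hxt, EReal.coe_le_coe_iff] at hxc
  by_cases hzR : z ∈ Metric.closedBall (0 : E) R
  · have h : φ x ≤ φ z := hx hzR
    rwa [hφr x hxt, hφr z hz, EReal.coe_le_coe_iff] at h
  · rw [mem_closedBall_zero_iff, not_le] at hzR
    have h1 := hC z hz
    have h2 : 0 ≤ 2 * K / ε := by positivity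
    have h3 : 0 ≤ ‖c‖ := norm_nonneg c
    have h4 : 2 * K / ε ≤ ‖z‖ ^ 2 := by nlinarith
    rw [div_le_iff₀ hε] at h4
    linarith

/-- Every point of the domain of the conjugate is approximated by subgradients at which the
conjugate is not larger. -/
theorem exists_subgradient_norm_sub_le [ProperSpace E] {g : E → EReal}
    (hg : LowerSemicontinuous g) (hbot : ∀ x, g x ≠ ⊥) (htop : ∃ x, g x ≠ ⊤)
    (hconv : ConvexOn ℝ {x | g x ≠ ⊤} fun z => (g z).toReal) {y : E} {C η : ℝ}
    (hC : ∀ z, g z ≠ ⊤ → ⟪z, y⟫ - (g z).toReal ≤ C) (hη : 0 < η) :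
    ∃ x q, g x ≠ ⊤ ∧ (∀ z, g z ≠ ⊤ → (g x).toReal + ⟪q, z - x⟫ ≤ (g z).toReal) ∧
      ‖q - y‖ ≤ η ∧ ⟪x, q⟫ - (g x).toReal ≤ C := by
  obtain ⟨c, hc⟩ := id htop
  set L : ℝ := 2 * ((g c).toReal - ⟪c, y⟫ + C) + ‖c‖ ^ 2 + 1 with hL
  have hL0 : 0 < L := by
    have := hC c hc
    have : 0 ≤ ‖c‖ ^ 2 := by positivity
    linarith
  set ε : ℝ := min 1 (η ^ 2 / L) with hεd
  have hε : 0 < ε := by positivity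
  have hε1 : ε ≤ 1 := min_le_left _ _
  have hεL : ε * L ≤ η ^ 2 := (le_div_iff₀ hL0).1 (min_le_right _ _)
  obtain ⟨x, hx, hmin⟩ := hg.exists_isMin_add_quadratic hbot htop hC hε
  refine ⟨x, y - ε • x, hx, ?_, ?_, ?_⟩
  · refine hconv.subgradient_of_isMin_add_quadratic (ε := ε) hx hmin
  · rw [sub_sub_cancel_left, norm_neg, norm_smul, Real.norm_of_nonneg hε.le]
    refine le_of_sq_le_sq ?_ hη.le
    have h1 := hmin c hc
    have h2 := hC x hx
    have h3 : ε * ‖c‖ ^ 2 ≤ ‖c‖ ^ 2 := mul_le_of_le_one_left (by positivity) hε1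
    have h4 : ε * ‖x‖ ^ 2 ≤ L := by linarith
    have h5 := mul_le_mul_of_nonneg_left h4 hε.le
    nlinarith
  · have h2 := hC x hx
    rw [inner_sub_right, inner_smul_right, real_inner_self_eq_norm_sq]
    have : 0 ≤ ε * ‖x‖ ^ 2 := by positivity
    linarith

end InnerProduct

theorem convexOn_toReal_of_convex_epigraph {E : Type*} [AddCommGroup E] [Module ℝ E]
    {g : E → EReal} (hbot : ∀ x, g x ≠ ⊥)
    (hconv : Convex ℝ {p : E × ℝ | g p.1 ≤ (p.2 : EReal)}) :
    ConvexOn ℝ {x | g x ≠ ⊤} fun z => (g z).toReal := by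
  have key : ∀ ⦃x⦄, g x ≠ ⊤ → ∀ ⦃z⦄, g z ≠ ⊤ → ∀ ⦃a b : ℝ⦄, 0 ≤ a → 0 ≤ b → a + b = 1 →
      g (a • x + b • z) ≤ ((a * (g x).toReal + b * (g z).toReal : ℝ) : EReal) := by
    intro x hx z hz a b ha hb hab
    exact hconv (x := (x, (g x).toReal)) (y := (z, (g z).toReal))
      (EReal.coe_toReal hx (hbot x)).ge (EReal.coe_toReal hz (hbot z)).ge ha hb hab
  have htop : ∀ ⦃x⦄, g x ≠ ⊤ → ∀ ⦃z⦄, g z ≠ ⊤ → ∀ ⦃a b : ℝ⦄, 0 ≤ a → 0 ≤ b → a + b = 1 →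
      g (a • x + b • z) ≠ ⊤ := fun x hx z hz a b ha hb hab =>
    ((key hx hz ha hb hab).trans_lt (EReal.coe_lt_top _)).ne
  refine ⟨fun x hx z hz a b ha hb hab => htop hx hz ha hb hab,
    fun x hx z hz a b ha hb hab => ?_⟩
  have h := key hx hz ha hb hab
  rwa [← EReal.coe_toReal (htop hx hz ha hb hab) (hbot _), EReal.coe_le_coe_iff] at h

theorem LowerSemicontinuous.le_of_forall_exists_norm_sub_le {E : Type*} [SeminormedAddCommGroup E]
    {f : E → EReal} (hf : LowerSemicontinuous f) {q : E} {c : EReal}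
    (h : ∀ η : ℝ, 0 < η → ∃ y, ‖y - q‖ ≤ η ∧ f y ≤ c) : f q ≤ c := by
  have hq : q ∈ closure (f ⁻¹' Set.Iic c) := Metric.mem_closure_iff.2 fun η hη => by
    obtain ⟨y, hy, hyc⟩ := h (η / 2) (half_pos hη)
    refine ⟨y, hyc, ?_⟩
    rw [dist_comm, dist_eq_norm]
    linarith
  rwa [(hf.isClosed_preimage c).closure_eq] at hq

theorem coe_inner_sub_le_fenchel {n : ℕ} {g : EuclideanSpace ℝ (Fin n) → EReal}
    {x y : EuclideanSpace ℝ (Fin n)} {r : ℝ} (hr : g x = (r : EReal)) :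
    ((⟪y, x⟫ - r : ℝ) : EReal) ≤ fenchel g y := by
  refine le_trans (le_of_eq ?_) (le_iSup _ x)
  rw [hr, sub_eq_add_neg, EReal.coe_add, EReal.coe_neg]

/-- If `f* ≤ g` with equality at a point `x` of differentiability of `g`, then `f (∇g x)` is at most
`⟪x, ∇g x⟫ - g x`. -/
theorem le_of_fenchel_eq_of_hasGradientAt {n : ℕ} {f g : EuclideanSpace ℝ (Fin n) → EReal}
    (hf : LowerSemicontinuous f) (hbot : ∀ x, g x ≠ ⊥) (hle : ∀ x, fenchel f x ≤ g x)
    {x q : EuclideanSpace ℝ (Fin n)} (hx : x ∈ interior {x | g x ≠ ⊤}) (hfx : fenchel f x = g x)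
    (hq : HasGradientAt (fun z => (g z).toReal) q x) :
    f q ≤ ((⟪x, q⟫ - (g x).toReal : ℝ) : EReal) := by
  have hxt : g x ≠ ⊤ := interior_subset hx
  refine EReal.le_of_forall_lt_iff_le.1 fun r hr => ?_
  rw [EReal.coe_lt_coe_iff] at hr
  set δ : ℝ := r - (⟪x, q⟫ - (g x).toReal) with hδ
  have hδ0 : 0 < δ := sub_pos.2 hr
  refine hf.le_of_forall_exists_norm_sub_le fun η hη => ?_
  obtain ⟨ε, hε, hclose⟩ := hq.exists_forall_norm_sub_le (mem_interior_iff_mem_nhds.1 hx)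
    (lt_min hη (show 0 < δ / 2 / (‖x‖ + 1) by positivity))
  have hlt : (((g x).toReal - min ε (δ / 2) : ℝ) : EReal) < fenchel f x := by
    rw [hfx, ← EReal.coe_toReal hxt (hbot x), EReal.toReal_coe, EReal.coe_lt_coe_iff]
    have : 0 < min ε (δ / 2) := by positivity
    linarith
  obtain ⟨y, hy⟩ := lt_iSup_iff.1 hlt
  have hyt : f y ≠ ⊤ := by
    intro h
    simp [h] at hy
  have hyb : f y ≠ ⊥ := by
    intro h
    have h1 := (le_iSup (fun y => ((⟪x, y⟫ : ℝ) : EReal) + (- f y)) y).trans (hle x)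
    simp only [h, EReal.neg_bot, EReal.coe_add_top] at h1
    exact hxt (top_le_iff.1 h1)
  obtain ⟨F, hF⟩ : ∃ F : ℝ, f y = F := ⟨_, (EReal.coe_toReal hyt hyb).symm⟩
  rw [hF, ← EReal.coe_neg, ← EReal.coe_add, EReal.coe_lt_coe_iff] at hy
  have hyq : ‖y - q‖ ≤ min η (δ / 2 / (‖x‖ + 1)) := by
    refine hclose y fun z hz => ?_
    have h1 := (coe_inner_sub_le_fenchel (y := z) hF).trans (hle z)
    rw [← EReal.coe_toReal hz (hbot z), EReal.coe_le_coe_iff] at h1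
    rw [inner_sub_right, real_inner_comm z y, real_inner_comm x y]
    have := min_le_left ε (δ / 2)
    linarith
  refine ⟨y, hyq.trans (min_le_left _ _), ?_⟩
  rw [hF, EReal.coe_le_coe_iff]
  have h1 : ‖y - q‖ * (‖x‖ + 1) ≤ δ / 2 :=
    (le_div_iff₀ (by positivity)).1 (hyq.trans (min_le_right _ _))
  have h2 := real_inner_le_norm x (y - q)
  rw [inner_sub_right] at h2
  have h3 := min_le_right ε (δ / 2)
  nlinarith [norm_nonneg (y - q)]

theorem fenchel_le_of_fenchel_le {n : ℕ} {f g : EuclideanSpace ℝ (Fin n) → EReal}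
    (hbot : ∀ x, g x ≠ ⊥) (htop : ∃ x, g x ≠ ⊤) (hle : ∀ x, fenchel f x ≤ g x)
    (y : EuclideanSpace ℝ (Fin n)) : fenchel g y ≤ f y := by
  have hyb : f y ≠ ⊥ := by
    intro h
    obtain ⟨c, hc⟩ := htop
    have h1 := (le_iSup (fun y => ((⟪c, y⟫ : ℝ) : EReal) + (- f y)) y).trans (hle c)
    simp only [h, EReal.neg_bot, EReal.coe_add_top] at h1
    exact hc (top_le_iff.1 h1)
  rcases eq_or_ne (f y) ⊤ with h | hyt
  · rw [h]; exact le_top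
  obtain ⟨F, hF⟩ : ∃ F : ℝ, f y = F := ⟨_, (EReal.coe_toReal hyt hyb).symm⟩
  refine iSup_le fun x => ?_
  rcases eq_or_ne (g x) ⊤ with h | hxt
  · simp [h]
  have h1 := (coe_inner_sub_le_fenchel (y := x) hF).trans (hle x)
  rw [← EReal.coe_toReal hxt (hbot x), EReal.coe_le_coe_iff] at h1
  rw [hF, ← EReal.coe_toReal hxt (hbot x), ← EReal.coe_neg, ← EReal.coe_add,
    EReal.coe_le_coe_iff, real_inner_comm]
  linarith

/-- An essentially smooth l.s.c. proper convex function `g` on `ℝⁿ` has a unique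
l.s.c. preimage by the Legendre–Fenchel transform; more precisely, any l.s.c. `f`
with `f* ≤ g` and `f* = g` on the interior of `dom g` satisfies `f = g*`. -/
theorem stmt17 {n : ℕ} (g : EuclideanSpace ℝ (Fin n) → EReal)
    (hg_lsc : LowerSemicontinuous g)
    (hg_nbot : ∀ x, g x ≠ ⊥) (hg_ntop : ∃ x, g x ≠ ⊤)
    (hg_cvx : Convex ℝ {p : EuclideanSpace ℝ (Fin n) × ℝ | g p.1 ≤ (p.2 : EReal)})
    (hD : (interior {x | g x ≠ ⊤}).Nonempty)
    (hdiff : ∀ x ∈ interior {x | g x ≠ ⊤},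
      DifferentiableAt ℝ (fun z => (g z).toReal) x)
    (hsteep : ∀ (u : ℕ → EuclideanSpace ℝ (Fin n)) (x₀ : EuclideanSpace ℝ (Fin n)),
      (∀ k, u k ∈ interior {x | g x ≠ ⊤}) →
      x₀ ∈ frontier {x | g x ≠ ⊤} →
      Tendsto u atTop (nhds x₀) →
      Tendsto (fun k => ‖gradient (fun z => (g z).toReal) (u k)‖) atTop atTop) :
    (∀ f : EuclideanSpace ℝ (Fin n) → EReal, LowerSemicontinuous f →
      (∀ x, fenchel f x ≤ g x) →
      (∀ x ∈ interior {x | g x ≠ ⊤}, fenchel f x = g x) →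
      f = fenchel g) ∧
    (∀ f : EuclideanSpace ℝ (Fin n) → EReal, LowerSemicontinuous f →
      fenchel f = g → f = fenchel g) := by
  have hconv := convexOn_toReal_of_convex_epigraph hg_nbot hg_cvx
  have main : ∀ f : EuclideanSpace ℝ (Fin n) → EReal, LowerSemicontinuous f →
      (∀ x, fenchel f x ≤ g x) →
      (∀ x ∈ interior {x | g x ≠ ⊤}, fenchel f x = g x) → f = fenchel g := by
    intro f hf hle heq
    funext y
    refine le_antisymm ?_ (fenchel_le_of_fenchel_le hg_nbot hg_ntop hle y)
    refine EReal.le_of_forall_lt_iff_le.1 fun C hC => ?_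
    have hC' : ∀ z, g z ≠ ⊤ → ⟪z, y⟫ - (g z).toReal ≤ C := by
      intro z hz
      have h := (coe_inner_sub_le_fenchel (y := y)
        (EReal.coe_toReal hz (hg_nbot z)).symm).trans hC.le
      rwa [EReal.coe_le_coe_iff, real_inner_comm] at h
    refine hf.le_of_forall_exists_norm_sub_le fun η hη => ?_
    obtain ⟨x, q, hx, hsub, hqy, hqC⟩ :=
      exists_subgradient_norm_sub_le hg_lsc hg_nbot hg_ntop hconv hC' hη
    have hxi := hconv.mem_interior_of_subgradient hD hdiff hsteep hx hsub
    have hgrad := (hdiff x hxi).hasGradientAt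
    have hqg : q = gradient (fun z => (g z).toReal) x := by
      refine eq_of_sub_eq_zero (norm_le_zero_iff.1 (le_of_forall_pos_le_add fun δ hδ => ?_))
      obtain ⟨ε, hε, hclose⟩ :=
        hgrad.exists_forall_norm_sub_le (mem_interior_iff_mem_nhds.1 hxi) hδ
      rw [zero_add]
      exact hclose q fun z hz => by linarith [hsub z hz]
    refine ⟨q, hqy, ?_⟩
    exact (le_of_fenchel_eq_of_hasGradientAt hf hg_nbot hle hxi (heq x hxi)
      (hqg ▸ hgrad)).trans (EReal.coe_le_coe_iff.2 hqC)
  exact ⟨main, fun f hf h => main f hf (fun x => (congrFun h x).le) fun x _ => congrFun h x⟩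
end

section
/- Let f : E → ℝ̄ be lower semicontinuous. Then f = B°(Bf) if, and only if, f is identically −∞ or there exists a > 0 such that the function y ↦ f(y) + a‖y‖^p is bounded from below (i.e. there is c ∈ ℝ with f(y) + a‖y‖^p ≥ c for all y ∈ E). Moreover, if dom(Bf) ≠ ∅, then f = B°(Bf). -/
/-- The Moreau conjugacy `B` with kernel `b((x',x''),y) = -x''‖x'-y‖^p`,
viewed as a function of `x' ∈ E` and `x'' ∈ ℝ` (only `x'' > 0` is relevant);
the convention is that `-∞` is absorbing for addition in `ℝ̄`. -/
noncomputable def Bp {E : Type*} [NormedAddCommGroup E] (p : ℝ)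
    (f : E → EReal) (x' : E) (x'' : ℝ) : EReal :=
  ⨆ y : E, ((-(x'' * ‖y - x'‖ ^ p) : ℝ) : EReal) + (- f y)

/-- The conjugacy `B°`, where the supremum is taken over `X = E × (0,+∞)`. -/
noncomputable def Bpgal {E : Type*} [NormedAddCommGroup E] (p : ℝ)
    (g : E → ℝ → EReal) (y : E) : EReal :=
  ⨆ x' : E, ⨆ x'' : {t : ℝ // 0 < t},
    ((-((x'' : ℝ) * ‖y - x'‖ ^ p) : ℝ) : EReal) + (- g x' (x'' : ℝ))

theorem EReal.coe_add_neg_le_coe_iff (k b : ℝ) (z : EReal) :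
    (k : EReal) + (-z) ≤ (b : EReal) ↔ ((k - b : ℝ) : EReal) ≤ z := by
  induction z using EReal.rec with
  | bot => simp [-EReal.coe_sub]
  | top => simp
  | coe z =>
    norm_cast
    constructor <;> intro h <;> linarith

theorem Bp_le_coe_iff {E : Type*} [NormedAddCommGroup E] (p : ℝ) (f : E → EReal)
    (x : E) (t b : ℝ) :
    Bp p f x t ≤ (b : EReal) ↔
      ∀ y, ((-(t * ‖y - x‖ ^ p) - b : ℝ) : EReal) ≤ f y := by
  simp only [Bp, iSup_le_iff, EReal.coe_add_neg_le_coe_iff]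

theorem Bpgal_Bp_le {E : Type*} [NormedAddCommGroup E] (p : ℝ) (f : E → EReal) (y : E) :
    Bpgal p (Bp p f) y ≤ f y := by
  refine iSup_le fun x => iSup_le fun t => ?_
  refine EReal.le_of_forall_lt_iff_le.1 fun z hz => ?_
  rw [EReal.coe_add_neg_le_coe_iff]
  refine le_trans ?_ (le_iSup (fun y => ((-((t : ℝ) * ‖y - x‖ ^ p) : ℝ) : EReal) + (- f y)) y)
  rw [EReal.coe_sub, sub_eq_add_neg]
  gcongr
  exact EReal.neg_le_neg_iff.2 hz.le

theorem norm_add_rpow_le {E : Type*} [NormedAddCommGroup E] {p : ℝ} (hp : 0 < p) (u v : E) :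
    ‖u + v‖ ^ p ≤ 2 ^ p * (‖u‖ ^ p + ‖v‖ ^ p) := by
  have key : ∀ u v : E, ‖u‖ ≤ ‖v‖ → ‖u + v‖ ^ p ≤ 2 ^ p * (‖u‖ ^ p + ‖v‖ ^ p) := by
    intro u v h
    have h₁ : ‖u + v‖ ≤ 2 * ‖v‖ := (norm_add_le u v).trans (by linarith)
    calc ‖u + v‖ ^ p ≤ (2 * ‖v‖) ^ p := by gcongr
      _ = 2 ^ p * ‖v‖ ^ p := Real.mul_rpow (by norm_num) (norm_nonneg v)
      _ ≤ 2 ^ p * (‖u‖ ^ p + ‖v‖ ^ p) := by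
        gcongr
        exact le_add_of_nonneg_left (by positivity)
  rcases le_total ‖u‖ ‖v‖ with h | h
  · exact key u v h
  · rw [add_comm u, add_comm (‖u‖ ^ p)]
    exact key v u h

theorem EReal.coe_le_add_coe_iff (c k : ℝ) (z : EReal) :
    (c : EReal) ≤ z + (k : EReal) ↔ ((c - k : ℝ) : EReal) ≤ z := by
  induction z using EReal.rec with
  | bot => simp [-EReal.coe_sub]
  | top => simp
  | coe z =>
    norm_cast
    constructor <;> intro h <;> linarith

theorem exists_le_add_norm_rpow_of_Bp_ne_top {E : Type*} [NormedAddCommGroup E]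
    {p : ℝ} (hp : 0 < p) {f : E → EReal} {x : E} {t : ℝ} (ht : 0 < t)
    (h : Bp p f x t ≠ ⊤) :
    ∃ a : ℝ, 0 < a ∧ ∃ c : ℝ, ∀ y : E,
      (c : EReal) ≤ f y + ((a * ‖y‖ ^ p : ℝ) : EReal) := by
  obtain ⟨b, hb, -⟩ := EReal.lt_iff_exists_real_btwn.1 h.lt_top
  rw [lt_iff_le_and_ne, Bp_le_coe_iff] at hb
  refine ⟨t * 2 ^ p, by positivity, -(t * 2 ^ p * ‖x‖ ^ p) - b, fun y => ?_⟩
  rw [EReal.coe_le_add_coe_iff]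
  refine le_trans (EReal.coe_le_coe_iff.2 ?_) (hb.1 y)
  have h₁ := norm_add_rpow_le hp y (-x)
  rw [norm_neg, ← sub_eq_add_neg] at h₁
  have h₂ := mul_le_mul_of_nonneg_left h₁ ht.le
  linarith

theorem eq_Bpgal_Bp_of_le_add_norm_rpow {E : Type*} [NormedAddCommGroup E]
    {p : ℝ} (hp : 0 < p) {f : E → EReal} (hf : LowerSemicontinuous f) {a c : ℝ} (ha : 0 < a)
    (h : ∀ y : E, (c : EReal) ≤ f y + ((a * ‖y‖ ^ p : ℝ) : EReal)) :
    f = Bpgal p (Bp p f) := by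
  funext x
  refine le_antisymm (EReal.ge_of_forall_gt_iff_ge.1 fun r hr => ?_) (Bpgal_Bp_le p f x)
  obtain ⟨δ, hδ, hball⟩ := Metric.eventually_nhds_iff.1 (hf x _ hr)
  have hδp : 0 < δ ^ p := by positivity
  set c' := c - a * 2 ^ p * ‖x‖ ^ p with hc'
  set t := a * 2 ^ p + |r - c'| / δ ^ p with ht
  have ht₀ : 0 < t := by positivity
  have hB : Bp p f x t ≤ ((-r : ℝ) : EReal) := by
    rw [Bp_le_coe_iff]
    intro y
    rcases lt_or_ge (dist y x) δ with hy | hy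
    · refine le_trans (EReal.coe_le_coe_iff.2 ?_) (hball hy).le
      have : 0 ≤ t * ‖y - x‖ ^ p := by positivity
      linarith
    · refine le_trans (EReal.coe_le_coe_iff.2 ?_) ((EReal.coe_le_add_coe_iff _ _ _).1 (h y))
      rw [dist_eq_norm] at hy
      have h₁ := norm_add_rpow_le hp (y - x) x
      rw [sub_add_cancel] at h₁
      have h₂ := mul_le_mul_of_nonneg_left h₁ ha.le
      have h₃ : δ ^ p ≤ ‖y - x‖ ^ p := by gcongr
      have h₄ : |r - c'| ≤ |r - c'| / δ ^ p * ‖y - x‖ ^ p := by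
        rw [div_mul_eq_mul_div, le_div_iff₀ hδp]
        gcongr
      have h₅ := le_abs_self (r - c')
      rw [ht, add_mul]
      linarith
  refine le_trans ?_ (le_iSup_of_le x (le_iSup_of_le ⟨t, ht₀⟩ le_rfl))
  simpa [Real.zero_rpow hp.ne', EReal.le_neg] using hB

/-- `f = B°(Bf)` iff `f ≡ -∞` or `f + a‖·‖^p` is bounded from below for some
`a > 0`; moreover this holds as soon as `dom(Bf) ≠ ∅`. -/
theorem stmt19 {E : Type*} [NormedAddCommGroup E] [NormedSpace ℝ E]
    (p : ℝ) (hp : 0 < p)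
    (f : E → EReal) (hf : LowerSemicontinuous f) :
    (f = Bpgal p (Bp p f) ↔
      ((∀ y, f y = ⊥) ∨
        ∃ a : ℝ, 0 < a ∧ ∃ c : ℝ, ∀ y : E,
          (c : EReal) ≤ f y + ((a * ‖y‖ ^ p : ℝ) : EReal))) ∧
    ((∃ x' : E, ∃ x'' : ℝ, 0 < x'' ∧ Bp p f x' x'' ≠ ⊤ ∧ Bp p f x' x'' ≠ ⊥) →
      f = Bpgal p (Bp p f)) := by
  refine ⟨⟨fun h => ?_, ?_⟩, ?_⟩
  · by_cases hB : ∃ x : E, ∃ t : ℝ, 0 < t ∧ Bp p f x t ≠ ⊤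
    · obtain ⟨x, t, ht, hxt⟩ := hB
      exact Or.inr (exists_le_add_norm_rpow_of_Bp_ne_top hp ht hxt)
    · push Not at hB
      refine Or.inl fun y => ?_
      rw [h]
      simp only [Bpgal, iSup_eq_bot]
      intro x t
      rw [hB x t t.2, EReal.neg_top, EReal.add_bot]
  · rintro (h | ⟨a, ha, c, h⟩)
    · funext y
      have h₁ := Bpgal_Bp_le p f y
      rw [h y] at h₁ ⊢
      exact (le_bot_iff.1 h₁).symm
    · exact eq_Bpgal_Bp_of_le_add_norm_rpow hp hf ha h
  · rintro ⟨x, t, ht, hxt, -⟩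
    obtain ⟨a, ha, c, h⟩ := exists_le_add_norm_rpow_of_Bp_ne_top hp ht hxt
    exact eq_Bpgal_Bp_of_le_add_norm_rpow hp hf ha h
end
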